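/- arXiv:2407.09160 — 2 statements merged into one kernel-verified Lean document; each statement's English description precedes it below -/
import Mathlib

section
/- Let M and N be two matroids on the same finite ground set V. Then the chromatic number of the complex M ∩ N of their common independent sets satisfies χ(M ∩ N) ≤ χ(M) + χ(N); that is, V can be covered by χ(M) + χ(N) sets each of which is independent in both M and N. -/
/-- A matroid on a finite ground set `V`, identified with its collection of
independent sets (here given as a predicate on `Finset V`). -/
structure FinMatroid (V : Type*) [DecidableEq V] where
  Indep : Finset V → Prop
  empty_indep : Indep ∅
  subset_indep : ∀ ⦃S T : Finset V⦄, Indep T → S ⊆ T → Indep S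
  augment : ∀ ⦃S T : Finset V⦄, Indep S → Indep T → S.card < T.card →
    ∃ v ∈ T, v ∉ S ∧ Indep (insert v S)

/-- The chromatic number of a complex (given by the predicate `Ind` of its faces)
on the finite ground set `V`: the minimum number of faces whose union is `V`. -/
noncomputable def chrom {V : Type*} [Fintype V] (Ind : Finset V → Prop) : ℕ :=
  sInf {n | ∃ f : Fin n → Finset V, (∀ i, Ind (f i)) ∧ ∀ v : V, ∃ i, v ∈ f i}

section CommonIndependentSets

open Finset

section Fermion

variable {W : Type*} [DecidableEq W]

/-- The sign of `x` relative to `σ`, where elements are compared through `κ`. -/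
def orderSign (κ : W → ℕ) (x : W) (σ : Finset W) : ℝ :=
  (-1) ^ (σ.filter fun y => κ y < κ x).card

/-- Exterior multiplication by the basis vector `x`. -/
def create (κ : W → ℕ) (x : W) (φ : Finset W → ℝ) (ρ : Finset W) : ℝ :=
  if x ∈ ρ then orderSign κ x ρ * φ (ρ.erase x) else 0

/-- Contraction with the basis vector `x`. -/
def annihilate (κ : W → ℕ) (x : W) (φ : Finset W → ℝ) (σ : Finset W) : ℝ :=
  if x ∈ σ then 0 else orderSign κ x σ * φ (insert x σ)

/-- The coboundary operator of the full simplex on `E`. -/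
def coboundary (κ : W → ℕ) (E : Finset W) (φ : Finset W → ℝ) (ρ : Finset W) : ℝ :=
  ∑ x ∈ E, create κ x φ ρ

/-- The (augmented) boundary operator of the full simplex on `E`. -/
def boundary (κ : W → ℕ) (E : Finset W) (φ : Finset W → ℝ) (σ : Finset W) : ℝ :=
  ∑ x ∈ E, annihilate κ x φ σ

omit [DecidableEq W] in
lemma orderSign_mul_self (κ : W → ℕ) (x : W) (σ : Finset W) :
    orderSign κ x σ * orderSign κ x σ = 1 := by
  unfold orderSign
  rw [← mul_pow]
  norm_num

lemma orderSign_insert (κ : W → ℕ) (x : W) {y : W} {σ : Finset W} (hy : y ∉ σ) :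
    orderSign κ x (insert y σ) = (if κ y < κ x then -1 else 1) * orderSign κ x σ := by
  unfold orderSign
  rw [filter_insert]
  split_ifs with h
  · rw [card_insert_of_notMem (by simp [hy]), pow_succ]
    ring
  · simp

lemma orderSign_erase_self (κ : W → ℕ) (x : W) (σ : Finset W) :
    orderSign κ x (σ.erase x) = orderSign κ x σ := by
  by_cases hx : x ∈ σ
  · have := orderSign_insert κ x (notMem_erase x σ)
    rw [insert_erase hx] at this
    simpa using this.symm
  · rw [erase_eq_of_notMem hx]

lemma orderSign_insert_self (κ : W → ℕ) (x : W) (σ : Finset W) :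
    orderSign κ x (insert x σ) = orderSign κ x σ := by
  by_cases hx : x ∈ σ
  · rw [insert_eq_of_mem hx]
  · rw [orderSign_insert κ x hx]
    simp

lemma orderSign_eq_erase (κ : W → ℕ) (x : W) {y : W} {σ : Finset W} (hy : y ∈ σ) :
    orderSign κ x σ = (if κ y < κ x then -1 else 1) * orderSign κ x (σ.erase y) := by
  rw [← orderSign_insert κ x (notMem_erase y σ), insert_erase hy]

lemma ite_lt_mul_ite_lt {a b : ℕ} (h : a ≠ b) :
    (if a < b then (-1 : ℝ) else 1) * (if b < a then -1 else 1) = -1 := by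
  rcases lt_or_gt_of_ne h with h | h <;> simp [h, not_lt_of_gt h]

lemma create_annihilate_anticomm {κ : W → ℕ} (hκ : Function.Injective κ) (x y : W)
    (φ : Finset W → ℝ) (σ : Finset W) :
    create κ x (annihilate κ y φ) σ + annihilate κ y (create κ x φ) σ =
      if x = y then φ σ else 0 := by
  unfold create annihilate
  by_cases hxy : x = y
  · subst hxy
    by_cases hx : x ∈ σ
    · simp [hx, orderSign_erase_self, insert_erase hx, ← mul_assoc, orderSign_mul_self]
    · simp [hx, orderSign_insert_self, ← mul_assoc, orderSign_mul_self]
  · have hyx : ¬ y = x := fun h => hxy h.symm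
    by_cases hx : x ∈ σ <;> by_cases hy : y ∈ σ <;> simp [hx, hy, hxy, hyx]
    rw [erase_insert_of_ne hyx, orderSign_insert κ x hy, orderSign_eq_erase κ y hx]
    have h := ite_lt_mul_ite_lt (hκ.ne hxy)
    linear_combination (orderSign κ x σ * orderSign κ y (σ.erase x) *
      φ (insert y (σ.erase x))) * h

lemma annihilate_anticomm {κ : W → ℕ} (hκ : Function.Injective κ) (x y : W)
    (φ : Finset W → ℝ) (σ : Finset W) :
    annihilate κ x (annihilate κ y φ) σ = - annihilate κ y (annihilate κ x φ) σ := by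
  unfold annihilate
  by_cases hxy : x = y
  · subst hxy
    simp
  · have hyx : ¬ y = x := fun h => hxy h.symm
    by_cases hx : x ∈ σ <;> by_cases hy : y ∈ σ <;> simp [hx, hy, hxy, hyx]
    rw [insert_comm y x, orderSign_insert κ x hy, orderSign_insert κ y hx]
    rcases lt_or_gt_of_ne (hκ.ne hxy) with h | h <;> simp [h, not_lt_of_gt h] <;> ring

lemma create_sum {ι : Type*} (κ : W → ℕ) (x : W) (s : Finset ι) (φ : ι → Finset W → ℝ)
    (ρ : Finset W) :
    create κ x (fun σ => ∑ i ∈ s, φ i σ) ρ = ∑ i ∈ s, create κ x (φ i) ρ := by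
  unfold create
  split_ifs <;> simp [mul_sum]

lemma annihilate_sum {ι : Type*} (κ : W → ℕ) (x : W) (s : Finset ι) (φ : ι → Finset W → ℝ)
    (ρ : Finset W) :
    annihilate κ x (fun σ => ∑ i ∈ s, φ i σ) ρ = ∑ i ∈ s, annihilate κ x (φ i) ρ := by
  unfold annihilate
  split_ifs <;> simp [mul_sum]

lemma coboundary_sum {ι : Type*} (κ : W → ℕ) (E : Finset W) (s : Finset ι)
    (φ : ι → Finset W → ℝ) (ρ : Finset W) :
    coboundary κ E (fun σ => ∑ i ∈ s, φ i σ) ρ = ∑ i ∈ s, coboundary κ E (φ i) ρ := by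
  unfold coboundary
  simp_rw [create_sum]
  exact sum_comm

lemma boundary_sum {ι : Type*} (κ : W → ℕ) (E : Finset W) (s : Finset ι)
    (φ : ι → Finset W → ℝ) (ρ : Finset W) :
    boundary κ E (fun σ => ∑ i ∈ s, φ i σ) ρ = ∑ i ∈ s, boundary κ E (φ i) ρ := by
  unfold boundary
  simp_rw [annihilate_sum]
  exact sum_comm

lemma boundary_add (κ : W → ℕ) (E : Finset W) (φ ψ : Finset W → ℝ) :
    boundary κ E (φ + ψ) = boundary κ E φ + boundary κ E ψ := by
  ext σ
  simp only [boundary, annihilate, Pi.add_apply, ← sum_add_distrib]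
  refine sum_congr rfl fun x _ => ?_
  split_ifs <;> ring

lemma boundary_smul (κ : W → ℕ) (E : Finset W) (c : ℝ) (φ : Finset W → ℝ) :
    boundary κ E (c • φ) = c • boundary κ E φ := by
  ext σ
  simp only [boundary, annihilate, Pi.smul_apply, smul_eq_mul, mul_sum]
  refine sum_congr rfl fun x _ => ?_
  split_ifs <;> ring

lemma boundary_boundary {κ : W → ℕ} (hκ : Function.Injective κ) (E : Finset W)
    (φ : Finset W → ℝ) (σ : Finset W) : boundary κ E (boundary κ E φ) σ = 0 := by
  have h : boundary κ E (boundary κ E φ) σ =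
      ∑ x ∈ E, ∑ y ∈ E, annihilate κ x (annihilate κ y φ) σ := by
    change ∑ x ∈ E, annihilate κ x (fun τ => ∑ y ∈ E, annihilate κ y φ τ) σ = _
    simp_rw [annihilate_sum]
  have h' : boundary κ E (boundary κ E φ) σ = - boundary κ E (boundary κ E φ) σ := by
    conv_lhs => rw [h, sum_comm]
    rw [h, ← sum_neg_distrib]
    refine sum_congr rfl fun x _ => ?_
    rw [← sum_neg_distrib]
    exact sum_congr rfl fun y _ => annihilate_anticomm hκ _ _ _ _
  linarith

lemma coboundary_boundary_add {κ : W → ℕ} (hκ : Function.Injective κ) (E : Finset W)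
    (φ : Finset W → ℝ) (σ : Finset W) :
    coboundary κ E (boundary κ E φ) σ + boundary κ E (coboundary κ E φ) σ = E.card * φ σ := by
  have h1 : coboundary κ E (boundary κ E φ) σ =
      ∑ x ∈ E, ∑ y ∈ E, create κ x (annihilate κ y φ) σ := by
    change ∑ x ∈ E, create κ x (fun τ => ∑ y ∈ E, annihilate κ y φ τ) σ = _
    simp_rw [create_sum]
  have h2 : boundary κ E (coboundary κ E φ) σ =
      ∑ x ∈ E, ∑ y ∈ E, annihilate κ y (create κ x φ) σ := by
    rw [sum_comm]
    change ∑ y ∈ E, annihilate κ y (fun τ => ∑ x ∈ E, create κ x φ τ) σ = _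
    simp_rw [annihilate_sum]
  rw [h1, h2, ← sum_add_distrib]
  simp_rw [← sum_add_distrib, create_annihilate_anticomm hκ]
  simp

variable [Fintype W]

lemma sum_create_mul (κ : W → ℕ) (x : W) (φ ψ : Finset W → ℝ) :
    ∑ σ, create κ x φ σ * ψ σ = ∑ σ, φ σ * annihilate κ x ψ σ := by
  unfold create annihilate
  simp only [ite_mul, mul_ite, zero_mul, mul_zero]
  rw [← sum_filter]
  have : ∀ σ : Finset W, (if x ∈ σ then (0 : ℝ) else φ σ * (orderSign κ x σ * ψ (insert x σ))) =
      if x ∉ σ then φ σ * (orderSign κ x σ * ψ (insert x σ)) else 0 := by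
    intro σ
    split_ifs <;> rfl
  simp_rw [this]
  rw [← sum_filter]
  refine sum_bij' (fun σ _ => σ.erase x) (fun σ _ => insert x σ) ?_ ?_ ?_ ?_ ?_
  · simp
  · simp
  · intro σ h
    exact insert_erase (by simpa using h)
  · intro σ h
    exact erase_insert (by simpa using h)
  · intro σ h
    rw [orderSign_erase_self, insert_erase (by simpa using h)]
    ring

lemma sum_coboundary_mul (κ : W → ℕ) (E : Finset W) (φ ψ : Finset W → ℝ) :
    ∑ σ, coboundary κ E φ σ * ψ σ = ∑ σ, φ σ * boundary κ E ψ σ := by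
  unfold coboundary boundary
  simp_rw [sum_mul, mul_sum]
  rw [sum_comm, sum_comm (s := univ)]
  exact sum_congr rfl fun x _ => sum_create_mul κ x φ ψ

lemma sum_coboundary_sq_add {κ : W → ℕ} (hκ : Function.Injective κ) (E : Finset W)
    (φ : Finset W → ℝ) :
    ∑ σ, coboundary κ E φ σ ^ 2 + ∑ σ, boundary κ E φ σ ^ 2 = E.card * ∑ σ, φ σ ^ 2 := by
  have h1 : ∑ σ, coboundary κ E φ σ ^ 2 = ∑ σ, φ σ * boundary κ E (coboundary κ E φ) σ := by
    rw [← sum_coboundary_mul]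
    exact sum_congr rfl fun _ _ => sq _
  have h2 : ∑ σ, boundary κ E φ σ ^ 2 = ∑ σ, φ σ * coboundary κ E (boundary κ E φ) σ := by
    have := sum_coboundary_mul κ E (boundary κ E φ) φ
    simp_rw [sq, ← this, mul_comm]
  rw [h1, h2, ← sum_add_distrib, mul_sum]
  refine sum_congr rfl fun σ _ => ?_
  linear_combination φ σ * coboundary_boundary_add hκ E φ σ

end Fermion

namespace FinMatroid

variable {W : Type*} [DecidableEq W] [Fintype W]

open Classical in
/-- The closure of a set in a matroid. -/
noncomputable def closure (M : FinMatroid W) (σ : Finset W) : Finset W :=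
  univ.filter fun x => x ∈ σ ∨ ¬ M.Indep (insert x σ)

lemma mem_closure (M : FinMatroid W) {σ : Finset W} {x : W} :
    x ∈ M.closure σ ↔ x ∈ σ ∨ ¬ M.Indep (insert x σ) := by
  simp [closure]

lemma card_closure_le (M : FinMatroid W) {p : ℕ} (f : Fin p → Finset W)
    (hf : ∀ i, M.Indep (f i)) (hcov : ∀ x, ∃ i, x ∈ f i) {σ : Finset W} (hσ : M.Indep σ) :
    (M.closure σ).card ≤ p * σ.card := by
  have hsub : M.closure σ ⊆ univ.biUnion fun i => f i ∩ M.closure σ := by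
    intro x hx
    obtain ⟨i, hi⟩ := hcov x
    simp only [mem_biUnion, mem_univ, true_and, mem_inter]
    exact ⟨i, hi, hx⟩
  calc (M.closure σ).card ≤ _ := card_le_card hsub
    _ ≤ (univ : Finset (Fin p)).card * σ.card := by
        refine card_biUnion_le_card_mul _ _ _ fun i _ => ?_
        by_contra! hlt
        obtain ⟨v, hv, hvσ, hind⟩ :=
          M.augment hσ (M.subset_indep (hf i) inter_subset_left) hlt
        rcases M.mem_closure.1 (mem_inter.1 hv).2 with h | h
        · exact hvσ h
        · exact h hind
    _ = p * σ.card := by simp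

lemma closure_subset_of_insert_eq (M : FinMatroid W) {σ τ : Finset W} {x y : W}
    (hτ : M.Indep τ) (hx : x ∉ σ) (hy : y ∉ τ)
    (h : insert x σ = insert y τ) (hdep : ¬ M.Indep (insert x σ)) :
    M.closure τ ⊆ M.closure σ := by
  intro z hz
  by_contra hzσ
  rw [mem_closure] at hz hzσ
  push Not at hzσ
  have hcard : τ.card = σ.card := by
    have := congrArg card h
    rw [card_insert_of_notMem hx, card_insert_of_notMem hy] at this
    omega
  obtain ⟨v, hv, hvτ, hind⟩ := M.augment hτ hzσ.2
    (by rw [card_insert_of_notMem hzσ.1]; omega)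
  rcases mem_insert.1 hv with rfl | hvσ
  · rcases hz with hz | hz
    · exact hvτ hz
    · exact hz hind
  · have hvy : v = y := by
      have : v ∈ insert y τ := h ▸ mem_insert_of_mem hvσ
      exact (mem_insert.1 this).resolve_right hvτ
    subst hvy
    exact hdep (h ▸ hind)

lemma closure_eq_of_insert_eq (M : FinMatroid W) {σ τ : Finset W} {x y : W}
    (hσ : M.Indep σ) (hτ : M.Indep τ) (hx : x ∉ σ) (hy : y ∉ τ)
    (h : insert x σ = insert y τ) (hdep : ¬ M.Indep (insert x σ)) :
    M.closure τ = M.closure σ :=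
  (M.closure_subset_of_insert_eq hτ hx hy h hdep).antisymm
    (M.closure_subset_of_insert_eq hσ hy hx h.symm (h ▸ hdep))

open Classical in
/-- The part of the coboundary of a cochain on independent sets that lives on dependent sets is
bounded by the largest size of a flat. -/
lemma sum_coboundary_sq_dep_le (M : FinMatroid W) {κ : W → ℕ} (hκ : Function.Injective κ)
    (E : Finset W) {p s : ℕ} (f : Fin p → Finset W) (hf : ∀ i, M.Indep (f i))
    (hcov : ∀ x, ∃ i, x ∈ f i) (φ : Finset W → ℝ)
    (hφ : ∀ σ, φ σ ≠ 0 → M.Indep σ ∧ σ.card = s) :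
    ∑ ρ with ¬ M.Indep ρ, coboundary κ E φ ρ ^ 2 ≤ (p * s : ℕ) * ∑ σ, φ σ ^ 2 := by
  set ψ : Finset W → Finset W → ℝ := fun F σ => if M.closure σ = F then φ σ else 0 with hψ
  have hψφ : ∀ F σ, ψ F σ ≠ 0 → M.closure σ = F ∧ M.Indep σ ∧ σ.card = s := by
    intro F σ h
    simp only [hψ, ne_eq, ite_eq_right_iff, not_forall] at h
    exact ⟨h.1, hφ σ h.2⟩
  have hsum : φ = fun σ => ∑ F, ψ F σ := by
    ext σ
    simp [hψ]
  have hterm : ∀ F ρ, coboundary κ E (ψ F) ρ ≠ 0 →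
      ∃ x ∈ ρ, M.closure (ρ.erase x) = F ∧ M.Indep (ρ.erase x) := by
    intro F ρ h
    obtain ⟨x, -, hx⟩ := exists_ne_zero_of_sum_ne_zero h
    unfold create at hx
    split_ifs at hx with hxρ
    · obtain ⟨h1, h2, -⟩ := hψφ F _ (right_ne_zero_of_mul hx)
      exact ⟨x, hxρ, h1, h2⟩
    · exact absurd rfl hx
  have hsq : ∀ ρ, ¬ M.Indep ρ → coboundary κ E φ ρ ^ 2 = ∑ F, coboundary κ E (ψ F) ρ ^ 2 := by
    intro ρ hρ
    rw [hsum, coboundary_sum]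
    by_cases hall : ∀ F, coboundary κ E (ψ F) ρ = 0
    · simp [hall]
    · push Not at hall
      obtain ⟨F₀, hF₀⟩ := hall
      have hz : ∀ F, F ≠ F₀ → coboundary κ E (ψ F) ρ = 0 := by
        intro F hF
        by_contra hne
        obtain ⟨x, hx, hxF, hxi⟩ := hterm F ρ hne
        obtain ⟨y, hy, hyF, hyi⟩ := hterm F₀ ρ hF₀
        refine hF ?_
        rw [← hxF, ← hyF]
        refine M.closure_eq_of_insert_eq hyi hxi (notMem_erase y ρ) (notMem_erase x ρ) ?_ ?_
        · rw [insert_erase hx, insert_erase hy]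
        · rwa [insert_erase hy]
      rw [sum_eq_single F₀ (fun F _ h => hz F h) (by simp),
        sum_eq_single F₀ (fun F _ h => by rw [hz F h]; simp) (by simp)]
  have hflat : ∀ F ρ, ¬ M.Indep ρ →
      coboundary κ E (ψ F) ρ = coboundary κ (E ∩ F) (ψ F) ρ := by
    intro F ρ hρ
    unfold coboundary
    refine (sum_subset inter_subset_left fun x hxE hx => ?_).symm
    unfold create
    split_ifs with hxρ
    · by_contra hne
      obtain ⟨h1, -, -⟩ := hψφ F _ (right_ne_zero_of_mul hne)
      refine hx (mem_inter.2 ⟨hxE, ?_⟩)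
      rw [← h1, mem_closure, insert_erase hxρ]
      exact Or.inr hρ
    · rfl
  have hbound : ∀ F, ∑ ρ with ¬ M.Indep ρ, coboundary κ E (ψ F) ρ ^ 2 ≤
      (p * s : ℕ) * ∑ σ, ψ F σ ^ 2 := by
    intro F
    by_cases h0 : ∃ σ, ψ F σ ≠ 0
    · obtain ⟨σ, hσ⟩ := h0
      obtain ⟨h1, h2, h3⟩ := hψφ F σ hσ
      have hcard : (E ∩ F).card ≤ p * s := by
        calc (E ∩ F).card ≤ F.card := card_le_card inter_subset_right
          _ ≤ p * s := by
            rw [← h1, ← h3]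
            exact M.card_closure_le f hf hcov h2
      calc ∑ ρ with ¬ M.Indep ρ, coboundary κ E (ψ F) ρ ^ 2
          = ∑ ρ with ¬ M.Indep ρ, coboundary κ (E ∩ F) (ψ F) ρ ^ 2 :=
            sum_congr rfl fun ρ hρ => by rw [hflat F ρ (by simpa using hρ)]
        _ ≤ ∑ ρ, coboundary κ (E ∩ F) (ψ F) ρ ^ 2 :=
            sum_le_sum_of_subset_of_nonneg (filter_subset _ _) fun _ _ _ => sq_nonneg _
        _ ≤ ∑ ρ, coboundary κ (E ∩ F) (ψ F) ρ ^ 2 + ∑ ρ, boundary κ (E ∩ F) (ψ F) ρ ^ 2 :=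
            le_add_of_nonneg_right (sum_nonneg fun _ _ => sq_nonneg _)
        _ = (E ∩ F).card * ∑ σ, ψ F σ ^ 2 := sum_coboundary_sq_add hκ _ _
        _ ≤ (p * s : ℕ) * ∑ σ, ψ F σ ^ 2 := by
            refine mul_le_mul_of_nonneg_right (by exact_mod_cast hcard)
              (sum_nonneg fun _ _ => sq_nonneg _)
    · push Not at h0
      have : ψ F = fun _ => 0 := funext h0
      rw [this]
      simp [coboundary, create]
  calc ∑ ρ with ¬ M.Indep ρ, coboundary κ E φ ρ ^ 2
      = ∑ ρ with ¬ M.Indep ρ, ∑ F, coboundary κ E (ψ F) ρ ^ 2 :=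
        sum_congr rfl fun ρ hρ => hsq ρ (by simpa using hρ)
    _ = ∑ F, ∑ ρ with ¬ M.Indep ρ, coboundary κ E (ψ F) ρ ^ 2 := sum_comm
    _ ≤ ∑ F, (p * s : ℕ) * ∑ σ, ψ F σ ^ 2 := sum_le_sum fun F _ => hbound F
    _ = (p * s : ℕ) * ∑ σ, φ σ ^ 2 := by
        rw [← mul_sum, sum_comm]
        congr 1
        refine sum_congr rfl fun σ _ => ?_
        simp [hψ, ite_pow]

end FinMatroid

/-- Orthogonal decomposition with respect to the standard inner product. -/
lemma exists_mem_sum_sub_mul_eq_zero {ι : Type*} [Fintype ι] (K : Submodule ℝ (ι → ℝ))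
    (z : ι → ℝ) : ∃ k ∈ K, ∀ w ∈ K, ∑ i, (z i - k i) * w i = 0 := by
  let e := (WithLp.linearEquiv 2 ℝ (ι → ℝ)).symm
  obtain ⟨y, hy, h, hh, hz⟩ :=
    (K.map e.toLinearMap).exists_add_mem_mem_orthogonal (e z)
  obtain ⟨k, hk, rfl⟩ := hy
  refine ⟨k, hk, fun w hw => ?_⟩
  have := (Submodule.mem_orthogonal' _ _).1 hh (e w) ⟨w, hw, rfl⟩
  have hsub : h = e (z - k) := by
    rw [map_sub, hz]
    simp
  rw [hsub] at this
  simpa [e, PiLp.inner_apply, mul_comm] using this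

section Acyclic

variable {W : Type*} [DecidableEq W]

/-- The chains spanned by the faces of size `s`, contained in `E`, of the complex `C`. -/
def faceChains (C : Finset W → Prop) (E : Finset W) (s : ℕ) : Submodule ℝ (Finset W → ℝ) where
  carrier := {φ | ∀ σ, φ σ ≠ 0 → C σ ∧ σ ⊆ E ∧ σ.card = s}
  zero_mem' := by simp
  add_mem' := by
    intro a b ha hb σ h
    by_cases h' : a σ = 0
    · exact hb σ (by simpa [h'] using h)
    · exact ha σ h'
  smul_mem' := by
    intro c a ha σ h
    exact ha σ (by rintro h'; simp [h'] at h)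

lemma boundary_mem_faceChains {C : Finset W → Prop} (hC : ∀ ⦃σ τ⦄, C τ → σ ⊆ τ → C σ)
    (κ : W → ℕ) {E : Finset W} {s : ℕ} {φ : Finset W → ℝ} (hφ : φ ∈ faceChains C E (s + 1)) :
    boundary κ E φ ∈ faceChains C E s := by
  intro σ h
  obtain ⟨x, -, hx⟩ := exists_ne_zero_of_sum_ne_zero h
  unfold annihilate at hx
  split_ifs at hx with hxσ
  · exact absurd rfl hx
  · obtain ⟨h1, h2, h3⟩ := hφ _ (right_ne_zero_of_mul hx)
    rw [card_insert_of_notMem hxσ] at h3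
    exact ⟨hC h1 (subset_insert _ _), (subset_insert _ _).trans h2, by omega⟩

lemma boundary_eq_boundary_univ [Fintype W] {C : Finset W → Prop} (κ : W → ℕ) {E : Finset W}
    {s : ℕ} {φ : Finset W → ℝ} (hφ : φ ∈ faceChains C E s) :
    boundary κ E φ = boundary κ univ φ := by
  ext σ
  unfold boundary
  refine sum_subset (subset_univ _) fun x _ hx => ?_
  unfold annihilate
  split_ifs with hxσ
  · rfl
  · by_contra hne
    exact hx ((hφ _ (right_ne_zero_of_mul hne)).2.1 (mem_insert_self _ _))

/-- The complex of common independent sets of two matroids covered by `p` and `q` independent sets,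
restricted to `E`, has no reduced homology on faces of size `s` if `(p + q) * s < E.card`. -/
lemma exists_boundary_eq [Fintype W] (M N : FinMatroid W) {κ : W → ℕ}
    (hκ : Function.Injective κ) (E : Finset W) {p q s : ℕ}
    (f : Fin p → Finset W) (hf : ∀ i, M.Indep (f i)) (hfc : ∀ x, ∃ i, x ∈ f i)
    (g : Fin q → Finset W) (hg : ∀ i, N.Indep (g i)) (hgc : ∀ x, ∃ i, x ∈ g i)
    (hs : (p + q) * s < E.card) {z : Finset W → ℝ}
    (hz : z ∈ faceChains (fun σ => M.Indep σ ∧ N.Indep σ) E s) (hcyc : boundary κ E z = 0) :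
    ∃ w ∈ faceChains (fun σ => M.Indep σ ∧ N.Indep σ) E (s + 1), boundary κ E w = z := by
  classical
  set C : Finset W → Prop := fun σ => M.Indep σ ∧ N.Indep σ with hCdef
  have hC : ∀ ⦃σ τ⦄, C τ → σ ⊆ τ → C σ := fun σ τ h hs =>
    ⟨M.subset_indep h.1 hs, N.subset_indep h.2 hs⟩
  let B : (Finset W → ℝ) →ₗ[ℝ] (Finset W → ℝ) :=
    { toFun := boundary κ E
      map_add' := boundary_add κ E
      map_smul' := boundary_smul κ E }
  obtain ⟨k, hk, horth⟩ := exists_mem_sum_sub_mul_eq_zero ((faceChains C E (s + 1)).map B) z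
  obtain ⟨w, hw, rfl⟩ := hk
  refine ⟨w, hw, ?_⟩
  set h : Finset W → ℝ := z - B w with hh
  have hmem : h ∈ faceChains C E s := sub_mem hz (boundary_mem_faceChains hC κ hw)
  have hBh : boundary κ E h = 0 := by
    have h1 : B h = B z - B (B w) := map_sub _ _ _
    have h2 : B (B w) = 0 := funext (boundary_boundary hκ E w)
    have h3 : B z = 0 := hcyc
    rw [h2, h3, sub_zero] at h1
    exact h1
  have hDw : ∀ u ∈ faceChains C E (s + 1), ∑ σ, coboundary κ E h σ * u σ = 0 := by
    intro u hu
    rw [sum_coboundary_mul]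
    exact horth (B u) ⟨u, hu, rfl⟩
  have hsupp : ∀ ρ, coboundary κ E h ρ ≠ 0 → ρ ⊆ E ∧ ρ.card = s + 1 := by
    intro ρ hρ
    obtain ⟨x, hxE, hx⟩ := exists_ne_zero_of_sum_ne_zero hρ
    unfold create at hx
    split_ifs at hx with hxρ
    · obtain ⟨-, h2, h3⟩ := hmem _ (right_ne_zero_of_mul hx)
      rw [card_erase_of_mem hxρ] at h3
      have := card_pos.2 ⟨x, hxρ⟩
      refine ⟨?_, by omega⟩
      rw [← insert_erase hxρ]
      exact insert_subset hxE h2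
    · exact absurd rfl hx
  have hzero : ∀ ρ, C ρ → coboundary κ E h ρ = 0 := by
    intro ρ hρ
    by_contra hne
    obtain ⟨h1, h2⟩ := hsupp ρ hne
    have := hDw (Pi.single ρ 1) (by
      intro σ hσ
      have : σ = ρ := by
        by_contra hσρ
        exact hσ (Pi.single_eq_of_ne hσρ _)
      subst this
      exact ⟨hρ, h1, h2⟩)
    simp [Pi.single_apply] at this
    exact hne this
  have hle : ∑ ρ, coboundary κ E h ρ ^ 2 ≤
      ∑ ρ with ¬ M.Indep ρ, coboundary κ E h ρ ^ 2 +
        ∑ ρ with ¬ N.Indep ρ, coboundary κ E h ρ ^ 2 := by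
    rw [sum_filter, sum_filter, ← sum_add_distrib]
    refine sum_le_sum fun ρ _ => ?_
    by_cases hM : M.Indep ρ <;> by_cases hN : N.Indep ρ
    · simp [hM, hN, hzero ρ ⟨hM, hN⟩]
    · simp [hM, hN]
    · simp [hM, hN]
    · simp only [hM, hN, not_false_eq_true, if_true]
      exact le_add_of_nonneg_right (sq_nonneg _)
  have hM := M.sum_coboundary_sq_dep_le hκ E f hf hfc h
    fun σ hσ => ⟨(hmem σ hσ).1.1, (hmem σ hσ).2.2⟩
  have hN := N.sum_coboundary_sq_dep_le hκ E g hg hgc h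
    fun σ hσ => ⟨(hmem σ hσ).1.2, (hmem σ hσ).2.2⟩
  have htot := sum_coboundary_sq_add hκ E h
  rw [hBh] at htot
  have hnn : 0 ≤ ∑ σ, h σ ^ 2 := sum_nonneg fun _ _ => sq_nonneg _
  have hcast : ((p + q) * s : ℝ) + 1 ≤ E.card := by exact_mod_cast hs
  have hnorm : ∑ σ, h σ ^ 2 = 0 := by
    push_cast at hM hN
    simp only [Pi.zero_apply, ne_eq, OfNat.ofNat_ne_zero, not_false_eq_true, zero_pow,
      sum_const_zero, add_zero] at htot
    nlinarith
  have h0 : h = 0 := by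
    ext σ
    have := (sum_eq_zero_iff_of_nonneg fun σ _ => sq_nonneg (h σ)).1 hnorm σ (mem_univ σ)
    simpa using this
  exact (sub_eq_zero.1 h0).symm

end Acyclic

section Rainbow

variable {V W : Type*} [DecidableEq V] [DecidableEq W]

lemma coboundary_coboundary [Fintype W] {κ : W → ℕ} (hκ : Function.Injective κ) (E : Finset W)
    (φ : Finset W → ℝ) (ρ : Finset W) : coboundary κ E (coboundary κ E φ) ρ = 0 := by
  have h := sum_coboundary_mul κ E (coboundary κ E φ) (Pi.single ρ 1)
  rw [sum_coboundary_mul κ E φ] at h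
  simpa [Pi.single_apply, boundary_boundary hκ] using h

/-- The indicator function of the sets meeting each fibre of `π` over `U` exactly once and
no other fibre. -/
def rainbow (π : W → V) (U : Finset V) (σ : Finset W) : ℝ :=
  if σ.image π = U ∧ σ.card = U.card then 1 else 0

omit [DecidableEq W] in
lemma rainbow_eq_zero {π : W → V} {U : Finset V} {σ : Finset W} {x : W} (hx : x ∈ σ)
    (hU : π x ∉ U) : rainbow π U σ = 0 := by
  refine if_neg fun h => hU ?_
  rw [← h.1]
  exact mem_image_of_mem π hx

omit [DecidableEq W] in
lemma rainbow_eq_zero_of_eq {π : W → V} {U : Finset V} {σ : Finset W} {x y : W} (hx : x ∈ σ)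
    (hy : y ∈ σ) (hxy : x ≠ y) (h : π x = π y) : rainbow π U σ = 0 := by
  refine if_neg fun h' => hxy ?_
  refine card_image_iff.1 ?_ hx hy h
  rw [h'.1, h'.2]

lemma rainbow_erase_of_mem {π : W → V} {U : Finset V} {σ : Finset W} {x : W} (hx : x ∈ σ)
    (hU : π x ∈ U) : rainbow π (U.erase (π x)) (σ.erase x) = rainbow π U σ := by
  unfold rainbow
  refine if_congr ⟨fun h => ⟨?_, ?_⟩, fun h => ⟨?_, ?_⟩⟩ rfl rfl
  · rw [← insert_erase hx, image_insert, h.1, insert_erase hU]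
  · rw [← card_erase_add_one hx, ← card_erase_add_one hU, h.2]
  · have hinj : Set.InjOn π σ := card_image_iff.1 (by rw [h.1, h.2])
    ext v
    rw [mem_erase, ← h.1]
    simp only [mem_image, mem_erase]
    constructor
    · rintro ⟨y, ⟨hyx, hy⟩, rfl⟩
      exact ⟨fun h' => hyx (hinj hy hx h'), y, hy, rfl⟩
    · rintro ⟨hv, y, hy, rfl⟩
      exact ⟨y, ⟨fun h' => hv (by rw [h']), hy⟩, rfl⟩
  · rw [card_erase_of_mem hx, card_erase_of_mem hU, h.2]

omit [DecidableEq W] in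
lemma orderSign_eq_one {κ : W → ℕ} {x : W} {σ : Finset W} (h : ∀ y ∈ σ, κ x ≤ κ y) :
    orderSign κ x σ = 1 := by
  unfold orderSign
  rw [filter_false_of_mem fun y hy => not_lt.2 (h y hy)]
  simp

lemma coboundary_rainbow [Fintype W] {κ : W → ℕ} (hκ : Function.Injective κ) {e : V → ℕ}
    (he : Function.Injective e) {π : W → V} (hπ : ∀ x y, e (π x) < e (π y) → κ x < κ y)
    {U : Finset V} {u : V} (hu : u ∈ U) (hmin : ∀ v ∈ U, e u ≤ e v) {σ : Finset W}
    (hσ : ∀ x ∈ σ, π x ∈ U) :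
    coboundary κ univ (rainbow π (U.erase u)) σ = rainbow π U σ := by
  unfold coboundary
  by_cases hx : ∃ x ∈ σ, π x = u
  · obtain ⟨x, hx, rfl⟩ := hx
    rw [sum_eq_single x]
    · unfold create
      rw [if_pos hx, rainbow_erase_of_mem hx hu]
      by_cases h0 : rainbow π U σ = 0
      · rw [h0, mul_zero]
      · rw [orderSign_eq_one, one_mul]
        intro y hy
        by_cases hxy : x = y
        · rw [hxy]
        · have hne : π x ≠ π y := fun h => h0 (rainbow_eq_zero_of_eq hx hy hxy h)
          exact (hπ _ _ (lt_of_le_of_ne (hmin _ (hσ y hy)) (he.ne hne))).le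
    · intro y _ hyx
      unfold create
      rw [rainbow_eq_zero (mem_erase.2 ⟨hyx.symm, hx⟩) (notMem_erase _ _)]
      simp
    · simp
  · push Not at hx
    have hR : rainbow π U σ = 0 := by
      refine if_neg fun h => ?_
      rw [← h.1] at hu
      obtain ⟨x, hxσ, hxu⟩ := mem_image.1 hu
      exact hx x hxσ hxu
    rw [hR]
    by_cases hall : ∀ x ∈ σ, rainbow π (U.erase u) (σ.erase x) = 0
    · refine sum_eq_zero fun x _ => ?_
      unfold create
      split_ifs with hxσ
      · rw [hall x hxσ, mul_zero]
      · rfl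
    · push Not at hall
      obtain ⟨x, hxσ, hxR⟩ := hall
      have hxR' : (σ.erase x).image π = U.erase u ∧ (σ.erase x).card = (U.erase u).card := by
        by_contra h
        exact hxR (if_neg h)
      obtain ⟨y, hy, hyx⟩ : ∃ y ∈ σ.erase x, π y = π x := by
        rw [← mem_image, hxR'.1]
        exact mem_erase.2 ⟨hx x hxσ, hσ x hxσ⟩
      obtain ⟨hyne, hyσ⟩ := mem_erase.1 hy
      have hyR' : (σ.erase y).image π = U.erase u ∧ (σ.erase y).card = (U.erase u).card := by
        refine ⟨hxR'.1 ▸ ?_, hxR'.2 ▸ by rw [card_erase_of_mem hxσ, card_erase_of_mem hyσ]⟩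
        have h1 : σ.erase x = insert y ((σ.erase x).erase y) := (insert_erase hy).symm
        have h2 : σ.erase y = insert x ((σ.erase x).erase y) := by
          rw [erase_right_comm, insert_erase (mem_erase.2 ⟨hyne.symm, hxσ⟩)]
        rw [h1, h2, image_insert, image_insert, hyx]
      rw [sum_eq_add_of_mem x y (mem_univ _) (mem_univ _) hyne.symm]
      · unfold create rainbow
        rw [if_pos hxσ, if_pos hyσ, if_pos hxR', if_pos hyR', orderSign_eq_erase κ x hyσ,
          orderSign_eq_erase κ y hxσ, ← orderSign_erase_self κ x (σ.erase y),
          ← orderSign_erase_self κ y (σ.erase x), erase_right_comm]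
        have hsame : orderSign κ x ((σ.erase x).erase y) = orderSign κ y ((σ.erase x).erase y) := by
          unfold orderSign
          congr 2
          refine filter_congr fun z hz => ?_
          rw [mem_erase] at hz
          have hne : π z ≠ π y := fun h => hxR (rainbow_eq_zero_of_eq hz.2 hy hz.1 h)
          rcases lt_or_gt_of_ne (he.ne hne) with h | h
          · exact iff_of_true (hπ _ _ (hyx ▸ h)) (hπ _ _ h)
          · exact iff_of_false (not_lt.2 (hπ _ _ (hyx ▸ h)).le) (not_lt.2 (hπ _ _ h).le)
        rw [hsame]
        rcases lt_or_gt_of_ne (hκ.ne hyne) with h | h <;> simp [h, not_lt_of_gt h]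
      · intro z _ hz
        unfold create
        rw [rainbow_eq_zero_of_eq (mem_erase.2 ⟨hz.1.symm, hxσ⟩) (mem_erase.2 ⟨hz.2.symm, hyσ⟩)
          hyne.symm hyx.symm]
        simp

variable [Fintype V] [Fintype W]

/-- If enough homology of the restrictions of `C` to unions of fibres vanishes, there is a chain map
from the simplex on `V` carried by these restrictions. -/
lemma exists_chain_family {κ : W → ℕ} {e : V → ℕ} (he : Function.Injective e) (π : W → V)
    {C : Finset W → Prop} (h0 : C ∅)
    (hC : ∀ (U : Finset V) (s : ℕ) (z : Finset W → ℝ), U.card = s + 1 →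
      z ∈ faceChains C (univ.filter fun x => π x ∈ U) s → boundary κ univ z = 0 →
      ∃ w ∈ faceChains C (univ.filter fun x => π x ∈ U) (s + 1), boundary κ univ w = z) (n : ℕ) :
    ∃ c : Finset V → Finset W → ℝ, c ∅ = Pi.single ∅ 1 ∧ ∀ U : Finset V, U.card ≤ n →
      c U ∈ faceChains C (univ.filter fun x => π x ∈ U) U.card ∧
      ∀ σ, boundary κ univ (c U) σ = coboundary e univ (fun U' => c U' σ) U := by
  induction n with
  | zero =>
    refine ⟨fun _ => Pi.single ∅ 1, rfl, fun U hU => ?_⟩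
    obtain rfl : U = ∅ := by simpa using hU
    refine ⟨fun σ hσ => ?_, fun σ => ?_⟩
    · obtain rfl : σ = ∅ := by
        by_contra h
        exact hσ (Pi.single_eq_of_ne h _)
      simpa using h0
    · simp [boundary, coboundary, annihilate, create]
  | succ n ih =>
    obtain ⟨c, hc0, hc⟩ := ih
    have hext : ∀ U : Finset V, ∃ w : Finset W → ℝ, U.card = n + 1 →
        w ∈ faceChains C (univ.filter fun x => π x ∈ U) (n + 1) ∧
        ∀ σ, boundary κ univ w σ = coboundary e univ (fun U' => c U' σ) U := by
      intro U
      by_cases hU : U.card = n + 1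
      · have hcard : ∀ u ∈ U, (U.erase u).card = n := fun u hu => by
          rw [card_erase_of_mem hu, hU, Nat.add_sub_cancel]
        obtain ⟨w, hw, hwz⟩ := hC U n (fun σ => coboundary e univ (fun U' => c U' σ) U) hU
          (by
            intro σ hσ
            obtain ⟨u, -, hu⟩ := exists_ne_zero_of_sum_ne_zero hσ
            unfold create at hu
            split_ifs at hu with huU
            · obtain ⟨h1, h2, h3⟩ := (hc _ (hcard u huU).le).1 σ (right_ne_zero_of_mul hu)
              rw [hcard u huU] at h3
              refine ⟨h1, fun x hx => ?_, h3⟩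
              have := h2 hx
              simp only [mem_filter, mem_univ, true_and, mem_erase] at this ⊢
              exact this.2
            · exact absurd rfl hu)
          (by
            ext σ
            rw [Pi.zero_apply, ← coboundary_coboundary he univ (fun U' => c U' σ) U]
            unfold coboundary
            rw [boundary_sum]
            refine sum_congr rfl fun u _ => ?_
            unfold create
            by_cases hu : u ∈ U
            · simp only [hu, if_true]
              have := congrFun (boundary_smul κ univ (orderSign e u U) (c (U.erase u))) σ
              refine this.trans ?_
              rw [Pi.smul_apply, (hc _ (hcard u hu).le).2, smul_eq_mul]
              rfl
            · simp [hu, boundary, annihilate])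
        exact ⟨w, fun _ => ⟨hw, fun σ => congrFun hwz σ⟩⟩
      · exact ⟨0, fun h => absurd h hU⟩
    choose w hw using hext
    refine ⟨fun U => if U.card = n + 1 then w U else c U, by simp [hc0], fun U hU => ?_⟩
    have hcob : ∀ σ, coboundary e univ
        (fun U' => (if U'.card = n + 1 then w U' else c U') σ) U =
        coboundary e univ (fun U' => c U' σ) U := by
      intro σ
      unfold coboundary create
      refine sum_congr rfl fun u _ => ?_
      by_cases hu : u ∈ U
      · have := card_erase_add_one hu
        simp only [hu, if_true]
        rw [if_neg (by omega)]
      · simp [hu]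
    by_cases hUn : U.card = n + 1
    · simp only [hcob, hUn, if_true]
      exact hw U hUn
    · simp only [hcob, hUn, if_false]
      exact hc U (by omega)

/-- A topological version of Hall's theorem. -/
lemma exists_image_eq_univ {κ : W → ℕ} (hκ : Function.Injective κ) {e : V → ℕ}
    (he : Function.Injective e) {π : W → V} (hπ : ∀ x y, e (π x) < e (π y) → κ x < κ y)
    {C : Finset W → Prop} (h0 : C ∅)
    (hC : ∀ (U : Finset V) (s : ℕ) (z : Finset W → ℝ), U.card = s + 1 →
      z ∈ faceChains C (univ.filter fun x => π x ∈ U) s → boundary κ univ z = 0 →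
      ∃ w ∈ faceChains C (univ.filter fun x => π x ∈ U) (s + 1), boundary κ univ w = z) :
    ∃ σ, C σ ∧ σ.image π = univ := by
  obtain ⟨c, hc0, hc⟩ := exists_chain_family he π h0 hC (univ : Finset V).card
  have hcU : ∀ U : Finset V, _ := fun U => hc U (card_le_univ U)
  have key : ∀ (n : ℕ) (U : Finset V), U.card = n → ∑ σ, c U σ * rainbow π U σ = 1 := by
    intro n
    induction n with
    | zero =>
      intro U hU
      obtain rfl : U = ∅ := by simpa using hU
      rw [hc0]
      simp [Pi.single_apply, rainbow]
    | succ n ih =>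
      intro U hU
      obtain ⟨u, hu, hmin⟩ := exists_min_image U e (card_pos.1 (by omega))
      have hsupp : ∀ σ, c U σ ≠ 0 → ∀ x ∈ σ, π x ∈ U := by
        intro σ hσ x hx
        simpa using ((hcU U).1 σ hσ).2.1 hx
      calc ∑ σ, c U σ * rainbow π U σ
          = ∑ σ, coboundary κ univ (rainbow π (U.erase u)) σ * c U σ := by
            refine sum_congr rfl fun σ _ => ?_
            by_cases hσ : c U σ = 0
            · simp [hσ]
            · rw [coboundary_rainbow hκ he hπ hu hmin (hsupp σ hσ), mul_comm]
        _ = ∑ σ, ∑ v, create e v (fun U' => c U' σ) U * rainbow π (U.erase u) σ := by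
            rw [sum_coboundary_mul]
            refine sum_congr rfl fun σ _ => ?_
            rw [(hcU U).2 σ, mul_comm, coboundary, sum_mul]
        _ = ∑ v, ∑ σ, create e v (fun U' => c U' σ) U * rainbow π (U.erase u) σ := sum_comm
        _ = ∑ σ, create e u (fun U' => c U' σ) U * rainbow π (U.erase u) σ := by
            refine sum_eq_single u (fun v _ hvu => ?_) (by simp)
            refine sum_eq_zero fun σ _ => ?_
            unfold create
            split_ifs with hv
            · by_cases hσ : c (U.erase v) σ = 0
              · simp [hσ]
              · rw [rainbow, if_neg, mul_zero]
                rintro ⟨h, -⟩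
                have hvm : v ∈ σ.image π := by
                  rw [h]
                  exact mem_erase.2 ⟨hvu, hv⟩
                obtain ⟨x, hx, rfl⟩ := mem_image.1 hvm
                have := ((hcU _).1 σ hσ).2.1 hx
                simp at this
            · rw [zero_mul]
        _ = ∑ σ, c (U.erase u) σ * rainbow π (U.erase u) σ := by
            refine sum_congr rfl fun σ _ => ?_
            unfold create
            rw [if_pos hu, orderSign_eq_one hmin, one_mul]
        _ = 1 := ih _ (by rw [card_erase_of_mem hu, hU, Nat.add_sub_cancel])
  have hne : ∑ σ, c univ σ * rainbow π univ σ ≠ 0 := by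
    rw [key _ univ rfl]
    exact one_ne_zero
  obtain ⟨σ, -, hσ⟩ := exists_ne_zero_of_sum_ne_zero hne
  refine ⟨σ, ((hcU univ).1 σ (left_ne_zero_of_mul hσ)).1, ?_⟩
  by_contra h
  exact right_ne_zero_of_mul hσ (if_neg fun h' => h h'.1)

end Rainbow

namespace FinMatroid

variable {V : Type*} [DecidableEq V] [Fintype V] {k : ℕ}

/-- The vertices whose copy labelled `c` belongs to `S`. -/
def slice (c : Fin k) (S : Finset (V × Fin k)) : Finset V :=
  univ.filter fun v => (v, c) ∈ S

lemma mem_slice {c : Fin k} {S : Finset (V × Fin k)} {v : V} : v ∈ slice c S ↔ (v, c) ∈ S := by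
  simp [slice]

lemma slice_mono (c : Fin k) {S T : Finset (V × Fin k)} (h : S ⊆ T) : slice c S ⊆ slice c T :=
  fun _ hv => mem_slice.2 (h (mem_slice.1 hv))

lemma card_eq_sum_card_slice (S : Finset (V × Fin k)) : S.card = ∑ c, (slice c S).card := by
  rw [card_eq_sum_card_fiberwise (f := Prod.snd) (t := univ) (fun _ _ => mem_coe.2 (mem_univ _))]
  refine sum_congr rfl fun c _ => ?_
  refine card_bij' (fun x _ => x.1) (fun v _ => (v, c)) ?_ ?_ ?_ ?_
  · rintro ⟨v, d⟩ h
    obtain ⟨h1, rfl⟩ := mem_filter.1 h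
    exact mem_slice.2 h1
  · intro v h
    exact mem_filter.2 ⟨mem_slice.1 h, rfl⟩
  · rintro ⟨v, d⟩ h
    obtain ⟨-, rfl⟩ := mem_filter.1 h
    rfl
  · intro v h
    rfl

lemma slice_insert_self (v : V) (c : Fin k) (S : Finset (V × Fin k)) :
    slice c (insert (v, c) S) = insert v (slice c S) := by
  ext w
  simp [mem_slice]

lemma slice_insert_of_ne (v : V) {c d : Fin k} (h : d ≠ c) (S : Finset (V × Fin k)) :
    slice d (insert (v, c) S) = slice d S := by
  ext w
  simp [mem_slice, h]

/-- The direct sum of `k` copies of a matroid. -/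
def copies (M : FinMatroid V) (k : ℕ) : FinMatroid (V × Fin k) where
  Indep S := ∀ c, M.Indep (slice c S)
  empty_indep c := M.subset_indep M.empty_indep fun v hv => by simp [mem_slice] at hv
  subset_indep _ _ hT hST c := M.subset_indep (hT c) (slice_mono c hST)
  augment S T hS hT hlt := by
    rw [card_eq_sum_card_slice S, card_eq_sum_card_slice T] at hlt
    obtain ⟨c, -, hc⟩ := exists_lt_of_sum_lt hlt
    obtain ⟨v, hvT, hvS, hv⟩ := M.augment (hS c) (hT c) hc
    refine ⟨(v, c), mem_slice.1 hvT, fun h => hvS (mem_slice.2 h), fun d => ?_⟩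
    by_cases hd : d = c
    · subst hd
      rwa [slice_insert_self]
    · rw [slice_insert_of_ne v hd]
      exact hS d

lemma copies_indep_product (M : FinMatroid V) (k : ℕ) {S : Finset V} (hS : M.Indep S) :
    (M.copies k).Indep (S ×ˢ univ) := by
  intro c
  refine M.subset_indep hS fun v hv => ?_
  simpa using mem_slice.1 hv

/-- If two matroids are covered by `p` and `q` independent sets, then their common independent sets
include `p + q` sets covering the ground set. -/
lemma exists_cover_inter (M N : FinMatroid V) {p q : ℕ}
    (f : Fin p → Finset V) (hf : ∀ i, M.Indep (f i)) (hfc : ∀ x, ∃ i, x ∈ f i)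
    (g : Fin q → Finset V) (hg : ∀ i, N.Indep (g i)) (hgc : ∀ x, ∃ i, x ∈ g i) :
    ∃ h : Fin (p + q) → Finset V, (∀ i, M.Indep (h i) ∧ N.Indep (h i)) ∧
      ∀ v : V, ∃ i, v ∈ h i := by
  let e : V → ℕ := fun v => Fintype.equivFin V v
  have he : Function.Injective e := fun a b h => (Fintype.equivFin V).injective (Fin.ext h)
  let κ : V × Fin (p + q) → ℕ := fun x => e x.1 * (p + q) + x.2
  have hπ : ∀ x y : V × Fin (p + q), e x.1 < e y.1 → κ x < κ y := by
    rintro ⟨v, c⟩ ⟨w, d⟩ h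
    have h1 : (e v + 1) * (p + q) ≤ e w * (p + q) := Nat.mul_le_mul_right _ h
    have h2 := c.isLt
    change e v * (p + q) + c < e w * (p + q) + d
    rw [add_mul, one_mul] at h1
    omega
  have hκ : Function.Injective κ := by
    rintro ⟨v, c⟩ ⟨w, d⟩ h
    have hvw : v = w := by
      by_contra hne
      rcases lt_or_gt_of_ne (he.ne hne) with h' | h'
      · exact (hπ (v, c) (w, d) h').ne h
      · exact (hπ (w, d) (v, c) h').ne' h
    subst hvw
    have : (c : ℕ) = d := Nat.add_left_cancel h
    rw [Fin.ext this]
  obtain ⟨σ, hσ, himg⟩ := exists_image_eq_univ hκ he (π := Prod.fst) hπ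
    (C := fun σ => (M.copies (p + q)).Indep σ ∧ (N.copies (p + q)).Indep σ)
    ⟨(M.copies _).empty_indep, (N.copies _).empty_indep⟩ (by
      intro U s z hU hz hcyc
      have hcard : (univ.filter fun x : V × Fin (p + q) => x.1 ∈ U).card = (p + q) * (s + 1) := by
        have : (univ.filter fun x : V × Fin (p + q) => x.1 ∈ U) = U ×ˢ univ := by
          ext x
          simp
        rw [this, card_product, hU, card_univ, Fintype.card_fin, mul_comm]
      obtain ⟨u, -⟩ := card_pos.1 (show 0 < U.card by omega)
      obtain ⟨i, -⟩ := hfc u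
      obtain ⟨w, hw, hwz⟩ := exists_boundary_eq (M.copies (p + q)) (N.copies (p + q)) hκ
        (univ.filter fun x => x.1 ∈ U) (fun i => f i ×ˢ univ)
        (fun i => M.copies_indep_product _ (hf i)) (fun x => by simpa using hfc x.1)
        (fun i => g i ×ˢ univ)
        (fun i => N.copies_indep_product _ (hg i)) (fun x => by simpa using hgc x.1)
        (by
          rw [hcard, mul_add, mul_one]
          have := i.isLt
          omega) hz (by rw [boundary_eq_boundary_univ κ hz, hcyc])
      exact ⟨w, hw, by rw [← boundary_eq_boundary_univ κ hw, hwz]⟩)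
  refine ⟨fun c => slice c σ, fun c => ⟨hσ.1 c, hσ.2 c⟩, fun v => ?_⟩
  obtain ⟨⟨w, c⟩, hx, rfl⟩ := mem_image.1 (himg ▸ mem_univ v : v ∈ σ.image Prod.fst)
  exact ⟨c, mem_slice.2 hx⟩

lemma exists_cover_chrom (M : FinMatroid V) (hM : ∀ v : V, M.Indep {v}) :
    ∃ f : Fin (chrom M.Indep) → Finset V, (∀ i, M.Indep (f i)) ∧ ∀ v : V, ∃ i, v ∈ f i :=
  Nat.sInf_mem (s := {n | ∃ f : Fin n → Finset V, (∀ i, M.Indep (f i)) ∧ ∀ v : V, ∃ i, v ∈ f i})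
    ⟨Fintype.card V, fun i => {(Fintype.equivFin V).symm i}, fun _ => hM _,
      fun v => ⟨Fintype.equivFin V v, by simp⟩⟩

end FinMatroid

end CommonIndependentSets

/-- For two (loopless) matroids `M` and `N` on the same finite ground set `V`,
`χ(M ∩ N) ≤ χ(M) + χ(N)`. -/
theorem chromatic_inter_le_add_chromatic {V : Type*} [DecidableEq V] [Fintype V]
    (M N : FinMatroid V) (hM : ∀ v : V, M.Indep {v}) (hN : ∀ v : V, N.Indep {v}) :
    chrom (fun S => M.Indep S ∧ N.Indep S) ≤ chrom M.Indep + chrom N.Indep := by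
  obtain ⟨f, hf, hfc⟩ := M.exists_cover_chrom hM
  obtain ⟨g, hg, hgc⟩ := N.exists_cover_chrom hN
  exact Nat.sInf_le (M.exists_cover_inter N f hf hfc g hg hgc)
end

section
/- Let M, N be two matroids on the same finite ground set V such that ν_{1,1}(M,N) > 0, and let p ≤ q be positive integers. Then there exist sets X_1,…,X_p independent in M, sets Y_1,…,Y_q independent in N, and an element z ∈ V with the following properties: (1) every v ∈ V \ {z} satisfies #v(X_1,…,X_p) = #v(Y_1,…,Y_q); (2) #z(X_1,…,X_p) = p, i.e., z belongs to every X_i; (3) Σ_{j=1}^q |Y_j| = ν_{p,q}(M,N). -/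
/-- `#v(A_1, …, A_k)`: the number of indices `i` with `v ∈ A i`. -/
def cnt {V : Type*} [DecidableEq V] {k : ℕ} (A : Fin k → Finset V) (v : V) : ℕ :=
  (Finset.univ.filter fun i => v ∈ A i).card

/-- The combinatorial parameter `ν_{p,q}(M,N)`: the maximum over choices of
`A_1, …, A_p` independent in `M` and `B_1, …, B_q` independent in `N` of
`Σ_{v ∈ V} min (#v(A_1,…,A_p)) (#v(B_1,…,B_q))`.  Here the two collections of
independent sets are given as predicates `MI`, `NI` on `Finset V`. -/
noncomputable def nu {V : Type*} [DecidableEq V] [Fintype V] (p q : ℕ)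
    (MI NI : Finset V → Prop) : ℕ :=
  sSup {n | ∃ (A : Fin p → Finset V) (B : Fin q → Finset V),
    (∀ i, MI (A i)) ∧ (∀ j, NI (B j)) ∧
    n = ∑ v : V, min (cnt A v) (cnt B v)}

section Perturbation

open Finset

/-- A finset over which all fibres have at least two points is at most half as large as its
preimage. -/
theorem two_mul_card_le_card_filter_mem {ι γ : Type*} [Fintype ι] [DecidableEq γ] (χ : ι → γ)
    (C : Finset γ) (hC : ∀ c ∈ C, 2 ≤ #{i | χ i = c}) : 2 * #C ≤ #{i | χ i ∈ C} := by
  rw [card_eq_sum_card_fiberwise (f := χ) (t := C) (by intro i hi; simpa using hi), mul_comm]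
  refine card_nsmul_le_sum _ _ _ fun c hc => (hC c hc).trans (card_le_card fun i hi => ?_)
  simp only [mem_filter, mem_univ, true_and] at hi ⊢
  exact ⟨hi ▸ hc, hi⟩

/-- If every fibre of `φ` over `A` and of `ψ` over `B` has at least two points, some nonzero
vector has zero sum on all of these fibres. -/
theorem exists_ne_zero_sum_fiber_eq_zero {ι α β : Type*} [Fintype ι] [Nonempty ι]
    [DecidableEq α] [DecidableEq β] (φ : ι → α) (ψ : ι → β) (A : Finset α) (B : Finset β)
    (hA : ∀ a ∈ A, 2 ≤ #{i | φ i = a}) (hB : ∀ b ∈ B, 2 ≤ #{i | ψ i = b}) :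
    ∃ d : ι → ℝ, d ≠ 0 ∧ (∀ a ∈ A, ∑ i with φ i = a, d i = 0) ∧
      ∀ b ∈ B, ∑ i with ψ i = b, d i = 0 := by
  classical
  by_contra! hcon
  have cardA := two_mul_card_le_card_filter_mem φ A hA
  have cardB := two_mul_card_le_card_filter_mem ψ B hB
  have leA := card_le_univ (univ.filter fun i => φ i ∈ A)
  have leB := card_le_univ (univ.filter fun i => ψ i ∈ B)
  let L : (ι → ℝ) →ₗ[ℝ] (A → ℝ) × (B → ℝ) :=
    { toFun := fun d => (fun a => ∑ i with φ i = a, d i, fun b => ∑ i with ψ i = b, d i)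
      map_add' := fun d e => by ext <;> simp [sum_add_distrib]
      map_smul' := fun c d => by ext <;> simp [mul_sum] }
  have hinj : Function.Injective L := by
    rw [← LinearMap.ker_eq_bot, LinearMap.ker_eq_bot']
    intro d hd
    by_contra hne
    obtain ⟨b, hb, hsum⟩ := hcon d hne fun a ha => congrFun (congrArg Prod.fst hd) ⟨a, ha⟩
    exact hsum (congrFun (congrArg Prod.snd hd) ⟨b, hb⟩)
  have hdim := LinearMap.finrank_le_finrank_of_injective hinj
  simp only [Module.finrank_fintype_fun_eq_card, Module.finrank_prod, Fintype.card_coe] at hdim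
  have hsurj : Function.Surjective L := by
    refine (LinearMap.injective_iff_surjective_of_finrank_eq_finrank ?_).1 hinj
    simp only [Module.finrank_fintype_fun_eq_card, Module.finrank_prod, Fintype.card_coe]
    omega
  have allA : (univ.filter fun i => φ i ∈ A) = univ := (card_eq_iff_eq_univ _).1 (by omega)
  have allB : (univ.filter fun i => ψ i ∈ B) = univ := (card_eq_iff_eq_univ _).1 (by omega)
  simp only [filter_eq_self, mem_univ, true_imp_iff] at allA allB
  obtain ⟨i₀⟩ := ‹Nonempty ι›
  obtain ⟨d, hd⟩ := hsurj (Pi.single ⟨φ i₀, allA i₀⟩ 1, 0)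
  have sumA : ∑ a : A, (L d).1 a = ∑ i, d i := by
    rw [← sum_fiberwise_of_maps_to (t := A) (fun i _ => allA i), ← sum_coe_sort A]
    rfl
  have sumB : ∑ b : B, (L d).2 b = ∑ i, d i := by
    rw [← sum_fiberwise_of_maps_to (t := B) (fun i _ => allB i), ← sum_coe_sort B]
    rfl
  rw [hd] at sumA sumB
  simp at sumA sumB
  linarith

/-- The nonnegative vectors lying below both set functions `g` and `h`. -/
def commonPolytope {V : Type*} (g h : Finset V → ℝ) : Set (V → ℝ) :=
  {w | (∀ v, 0 ≤ w v) ∧ (∀ S, ∑ v ∈ S, w v ≤ g S) ∧ ∀ S, ∑ v ∈ S, w v ≤ h S}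

theorem isCompact_commonPolytope {V : Type*} [Fintype V] (g h : Finset V → ℝ) :
    IsCompact (commonPolytope g h) := by
  refine (isCompact_Icc (a := (0 : V → ℝ)) (b := fun v => g {v})).of_isClosed_subset ?_ ?_
  · simp only [commonPolytope, Set.ofPred_and, Set.ofPred_forall]
    refine .inter (isClosed_iInter fun v => isClosed_le (by fun_prop) (by fun_prop))
      (.inter (isClosed_iInter fun S => isClosed_le (by fun_prop) (by fun_prop))
      (isClosed_iInter fun S => isClosed_le (by fun_prop) (by fun_prop)))
  · rintro w ⟨h0, hg, -⟩
    exact ⟨h0, fun v => by simpa using hg {v}⟩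

open Filter Topology in
/-- Moving slightly in a direction that vanishes on all tight constraints preserves feasibility. -/
theorem eventually_add_smul_mem_commonPolytope {V : Type*} [Fintype V] {g h : Finset V → ℝ} {w d : V → ℝ}
    (hw : w ∈ commonPolytope g h) (hd0 : ∀ v, w v = 0 → d v = 0)
    (hdg : ∀ S, ∑ v ∈ S, w v = g S → ∑ v ∈ S, d v = 0)
    (hdh : ∀ S, ∑ v ∈ S, w v = h S → ∑ v ∈ S, d v = 0) :
    ∀ᶠ ε in 𝓝 (0 : ℝ), w + ε • d ∈ commonPolytope g h := by
  have key (a b c : ℝ) (hab : a ≤ b) (hc : a = b → c = 0) : ∀ᶠ ε in 𝓝 (0 : ℝ), a + ε * c ≤ b := by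
    rcases hab.eq_or_lt with hab | hab
    · simp [hc hab, hab]
    · have : Tendsto (fun ε : ℝ => a + ε * c) (𝓝 0) (𝓝 (a + 0 * c)) :=
        Continuous.tendsto (by fun_prop) _
      rw [zero_mul, add_zero] at this
      exact (this.eventually_lt_const hab).mono fun _ => le_of_lt
  simp only [commonPolytope, Set.mem_ofPred_eq, eventually_and, eventually_all, Pi.add_apply,
    Pi.smul_apply, smul_eq_mul, sum_add_distrib, ← mul_sum]
  refine ⟨fun v => ?_, fun S => key _ _ _ (hw.2.1 S) (hdg S), fun S => key _ _ _ (hw.2.2 S) (hdh S)⟩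
  filter_upwards [key (-w v) 0 (-d v) (by simpa using hw.1 v) (by simpa using hd0 v)] with ε hε
  linarith

variable {V : Type*} [DecidableEq V]

/-- A vector supported on `F` with zero sum on all members of two set families exists if each
point of `F` is either avoided by a family or not distinguished by it from another point of `F`. -/
theorem exists_ne_zero_sum_mem_eq_zero [Fintype V] (F : Finset V) (hF : F.Nonempty)
    (𝒮 𝒯 : Finset (Finset V))
    (hS : ∀ z ∈ F, ∀ S ∈ 𝒮, z ∈ S → ∃ u ∈ F, u ≠ z ∧ ∀ T ∈ 𝒮, u ∈ T ↔ z ∈ T)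
    (hT : ∀ z ∈ F, ∀ S ∈ 𝒯, z ∈ S → ∃ u ∈ F, u ≠ z ∧ ∀ T ∈ 𝒯, u ∈ T ↔ z ∈ T) :
    ∃ d : V → ℝ, d ≠ 0 ∧ (∀ v ∉ F, d v = 0) ∧ (∀ S ∈ 𝒮, ∑ v ∈ S, d v = 0) ∧
      ∀ S ∈ 𝒯, ∑ v ∈ S, d v = 0 := by
  have : Nonempty F := hF.to_subtype
  let cl (𝒰 : Finset (Finset V)) (v : F) : Finset (Finset V) := {S ∈ 𝒰 | (v : V) ∈ S}
  have fiber (𝒰 : Finset (Finset V))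
      (hU : ∀ z ∈ F, ∀ S ∈ 𝒰, z ∈ S → ∃ u ∈ F, u ≠ z ∧ ∀ T ∈ 𝒰, u ∈ T ↔ z ∈ T) :
      ∀ a ∈ (univ.image (cl 𝒰)).erase ∅, 2 ≤ #{i | cl 𝒰 i = a} := by
    intro a ha
    obtain ⟨hne, ha⟩ := mem_erase.1 ha
    obtain ⟨z, -, rfl⟩ := mem_image.1 ha
    obtain ⟨S, hS⟩ := nonempty_iff_ne_empty.2 hne
    obtain ⟨hS, hz⟩ := mem_filter.1 hS
    obtain ⟨u, hu, huz, h⟩ := hU z z.2 S hS hz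
    refine one_lt_card.2 ⟨⟨u, hu⟩, ?_, z, by simp, fun h => huz (congrArg Subtype.val h)⟩
    simpa [cl] using filter_congr h
  obtain ⟨d, hd, hdS, hdT⟩ := exists_ne_zero_sum_fiber_eq_zero (cl 𝒮) (cl 𝒯) _ _
    (fiber 𝒮 hS) (fiber 𝒯 hT)
  let e : V → ℝ := fun v => if h : v ∈ F then d ⟨v, h⟩ else 0
  have sum_eq (𝒰 : Finset (Finset V))
      (hU : ∀ a ∈ (univ.image (cl 𝒰)).erase ∅, ∑ i with cl 𝒰 i = a, d i = 0) :
      ∀ S ∈ 𝒰, ∑ v ∈ S, e v = 0 := by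
    intro S hS
    have h1 : ∑ v ∈ S, e v = ∑ i ∈ univ.filter (fun i : F => (i : V) ∈ S), d i := by
      have h2 : ∑ v ∈ S, e v = ∑ v ∈ F, if v ∈ S then e v else 0 := by
        rw [← sum_filter, filter_mem_eq_inter, inter_comm]
        refine (sum_subset inter_subset_left fun v hv hv' => ?_).symm
        have : v ∉ F := fun h => hv' (mem_inter.2 ⟨hv, h⟩)
        simp [e, this]
      rw [h2, ← sum_coe_sort, sum_filter]
      exact sum_congr rfl fun i _ => by simp [e]
    rw [h1, ← sum_fiberwise_of_maps_to (g := cl 𝒰)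
      (t := ((univ.image (cl 𝒰)).erase ∅).filter (S ∈ ·))]
    · refine sum_eq_zero fun a ha => ?_
      obtain ⟨ha, hSa⟩ := mem_filter.1 ha
      rw [← hU a ha, filter_filter]
      refine sum_congr (filter_congr fun i _ => ⟨And.right, fun h => ⟨?_, h⟩⟩) fun _ _ => rfl
      subst h
      exact (mem_filter.1 hSa).2
    · intro i hi
      have hSi : S ∈ cl 𝒰 i := mem_filter.2 ⟨hS, (mem_filter.1 hi).2⟩
      exact mem_filter.2 ⟨mem_erase.2 ⟨ne_empty_of_mem hSi, mem_image_of_mem _ (mem_univ _)⟩, hSi⟩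
  refine ⟨e, fun h => hd ?_, fun v hv => by simp [e, hv], sum_eq 𝒮 hdS, sum_eq 𝒯 hdT⟩
  ext i
  simpa [e] using congrFun h i

/-- A set function is submodular. -/
def IsSubmodular {R : Type*} [Add R] [LE R] (g : Finset V → R) : Prop :=
  ∀ S T, g (S ∪ T) + g (S ∩ T) ≤ g S + g T

theorem IsSubmodular.sum_eq_union_inter {g : Finset V → ℝ} (hg : IsSubmodular g) {w : V → ℝ}
    (hw : ∀ S, ∑ v ∈ S, w v ≤ g S) {S T : Finset V} (hS : ∑ v ∈ S, w v = g S)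
    (hT : ∑ v ∈ T, w v = g T) :
    ∑ v ∈ S ∪ T, w v = g (S ∪ T) ∧ ∑ v ∈ S ∩ T, w v = g (S ∩ T) := by
  have h1 := sum_union_inter (s₁ := S) (s₂ := T) (f := w)
  have h2 := hg S T
  have h3 := hw (S ∪ T)
  have h4 := hw (S ∩ T)
  constructor <;> linarith

/-- If tight sets separate `z` from all other points of `F`, and some tight set contains `z`, then
`z` is the only point of `F` in a difference of two nested tight sets. -/
theorem IsSubmodular.exists_tight_sdiff [Fintype V] {g : Finset V → ℝ} (hg : IsSubmodular g)
    (hg0 : g ∅ = 0) {w : V → ℝ} (hw : ∀ S, ∑ v ∈ S, w v ≤ g S) {F : Finset V} {z : V}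
    {T : Finset V} (hT : ∑ v ∈ T, w v = g T) (hzT : z ∈ T)
    (hsep : ∀ u ∈ F, u ≠ z → ∃ S, ∑ v ∈ S, w v = g S ∧ ¬(u ∈ S ↔ z ∈ S)) :
    ∃ D E, ∑ v ∈ D \ E, w v = g D - g E ∧ z ∈ D \ E ∧ ∀ u ∈ D \ E, u ∈ F → u = z := by
  classical
  obtain ⟨D, hD, hDmin⟩ := exists_min_image
    (univ.filter fun S : Finset V => ∑ v ∈ S, w v = g S ∧ z ∈ S) card
    ⟨T, by simp [hT, hzT]⟩
  obtain ⟨E, hE, hEmax⟩ := exists_max_image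
    (univ.filter fun S : Finset V => ∑ v ∈ S, w v = g S ∧ z ∉ S) card
    ⟨∅, by simp [hg0]⟩
  simp only [mem_filter, mem_univ, true_and] at hD hDmin hE hEmax
  have hU := (hg.sum_eq_union_inter hw hD.1 hE.1).1
  refine ⟨D ∪ E, E, ?_, by simp [hD.2, hE.2], ?_⟩
  · have := sum_sdiff (f := w) (subset_union_right : E ⊆ D ∪ E)
    linarith [hE.1]
  · intro u hu huF
    have huDE : u ∈ D ∧ u ∉ E := by
      simp only [mem_sdiff, mem_union] at hu
      tauto
    by_contra hne
    obtain ⟨S, hS, hsepS⟩ := hsep u huF hne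
    by_cases hzS : z ∈ S
    · have huS : u ∉ S := by tauto
      have := hDmin (D ∩ S) ⟨(hg.sum_eq_union_inter hw hD.1 hS).2, mem_inter.2 ⟨hD.2, hzS⟩⟩
      have hlt : #(D ∩ S) < #D := card_lt_card
        ⟨inter_subset_left, fun h => huS (mem_inter.1 (h huDE.1)).2⟩
      omega
    · have huS : u ∈ S := by tauto
      have := hEmax (E ∪ S) ⟨(hg.sum_eq_union_inter hw hE.1 hS).1, by simp [hE.2, hzS]⟩
      have hlt : #E < #(E ∪ S) := card_lt_card
        ⟨subset_union_left, fun h => huDE.2 (h (mem_union_right _ huS))⟩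
      omega

open Filter Topology in
/-- At an extreme point `w`, every nonempty set `F` of points of the support meets the difference
of two nested tight sets in a single point. -/
theorem exists_tight_sdiff_of_mem_extremePoints [Fintype V] {g h : Finset V → ℝ}
    (hg : IsSubmodular g) (hh : IsSubmodular h) (hg0 : g ∅ = 0) (hh0 : h ∅ = 0) {w : V → ℝ}
    (hw : w ∈ (commonPolytope g h).extremePoints ℝ) {F : Finset V} (hF : F.Nonempty)
    (hpos : ∀ v ∈ F, w v ≠ 0) :
    ∃ k, (k = g ∨ k = h) ∧ ∃ z ∈ F, ∃ D E, ∑ v ∈ D \ E, w v = k D - k E ∧ z ∈ D \ E ∧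
      ∀ u ∈ D \ E, u ∈ F → u = z := by
  classical
  by_contra! hcon
  obtain ⟨d, hd, hdF, hdg, hdh⟩ := exists_ne_zero_sum_mem_eq_zero F hF
    (univ.filter fun S => ∑ v ∈ S, w v = g S) (univ.filter fun S => ∑ v ∈ S, w v = h S)
    (by
      intro z hz S hS hzS
      by_contra! hsep
      obtain ⟨D, E, h1, h2, h3⟩ := hg.exists_tight_sdiff hg0 hw.1.2.1 (F := F)
        (mem_filter.1 hS).2 hzS (fun u hu huz => by
          obtain ⟨S, hS, h⟩ := hsep u hu huz
          exact ⟨S, (mem_filter.1 hS).2, by tauto⟩)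
      obtain ⟨u, hu, huF, hne⟩ := hcon g (.inl rfl) z hz D E h1 h2
      exact hne (h3 u hu huF))
    (by
      intro z hz S hS hzS
      by_contra! hsep
      obtain ⟨D, E, h1, h2, h3⟩ := hh.exists_tight_sdiff hh0 hw.1.2.2 (F := F)
        (mem_filter.1 hS).2 hzS (fun u hu huz => by
          obtain ⟨S, hS, h⟩ := hsep u hu huz
          exact ⟨S, (mem_filter.1 hS).2, by tauto⟩)
      obtain ⟨u, hu, huF, hne⟩ := hcon h (.inr rfl) z hz D E h1 h2
      exact hne (h3 u hu huF))
  have hev := eventually_add_smul_mem_commonPolytope hw.1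
    (fun v hv => hdF v fun hvF => hpos v hvF hv)
    (fun S hS => hdg S (by simpa using hS)) (fun S hS => hdh S (by simpa using hS))
  have hev' : ∀ᶠ ε in 𝓝 (0 : ℝ), w + (-ε) • d ∈ commonPolytope g h :=
    (by simpa using (continuous_neg (G := ℝ)).tendsto 0 : Tendsto Neg.neg (𝓝 (0 : ℝ)) (𝓝 0)) hev
  obtain ⟨ε, ⟨h1, h2⟩, hε⟩ := ((hev.and hev').filter_mono nhdsWithin_le_nhds |>.and
    (self_mem_nhdsWithin (s := {0}ᶜ))).exists
  have := hw.2 h1 h2 ⟨1 / 2, 1 / 2, by norm_num, by norm_num, by norm_num, by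
    ext v
    simp
    ring⟩
  simp only [add_eq_left, smul_eq_zero] at this
  exact this.elim hε hd

/-- A maximum integral vector below the two multiples `p • r` and `q • s` of rank functions exists
which, unless it is zero, has an entry equal to `p`. It is maximum even among real vectors. -/
theorem exists_integral_max_eq [Fintype V] {r s : Finset V → ℕ}
    (hr : IsSubmodular r) (hs : IsSubmodular s) (hr0 : r ∅ = 0) (hs0 : s ∅ = 0)
    (hr1 : ∀ v, r {v} ≤ 1) {p q : ℕ} (hpq : p ≤ q) :
    ∃ w : V → ℕ, (∀ S, ∑ v ∈ S, w v ≤ p * r S) ∧ (∀ S, ∑ v ∈ S, w v ≤ q * s S) ∧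
      (∀ w' : V → ℕ, (∀ S, ∑ v ∈ S, w' v ≤ p * r S) → (∀ S, ∑ v ∈ S, w' v ≤ q * s S) →
        ∑ v, w' v ≤ ∑ v, w v) ∧
      (w ≠ 0 → ∃ z, w z = p) := by
  classical
  set g : Finset V → ℝ := fun S => p * r S with hgdef
  set h : Finset V → ℝ := fun S => q * s S with hhdef
  have submod {k : ℕ} {t : Finset V → ℕ} (ht : IsSubmodular t) :
      IsSubmodular fun S => (k * t S : ℝ) := by
    intro S T
    have : (t (S ∪ T) + t (S ∩ T) : ℝ) ≤ t S + t T := mod_cast ht S T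
    dsimp only
    rw [← mul_add, ← mul_add]
    exact mul_le_mul_of_nonneg_left this (Nat.cast_nonneg k)
  have hg : IsSubmodular g := submod hr
  have hh : IsSubmodular h := submod hs
  have hQ := isCompact_commonPolytope g h
  have h0Q : (0 : V → ℝ) ∈ commonPolytope g h :=
    ⟨by simp, fun S => by simp only [hgdef, Pi.zero_apply, sum_const_zero]; positivity,
      fun S => by simp only [hhdef, Pi.zero_apply, sum_const_zero]; positivity⟩
  let ℓ : StrongDual ℝ (V → ℝ) := ∑ v, ContinuousLinearMap.proj v
  have hℓ (w : V → ℝ) : ℓ w = ∑ v, w v := by simp [ℓ]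
  have hexp : IsExposed ℝ (commonPolytope g h) (ℓ.toExposed (commonPolytope g h)) :=
    ContinuousLinearMap.toExposed.isExposed
  obtain ⟨w₀, hw₀, hmax₀⟩ := hQ.exists_isMaxOn ⟨0, h0Q⟩ ℓ.continuous.continuousOn
  obtain ⟨w, hw⟩ := (hexp.isCompact hQ).extremePoints_nonempty ⟨w₀, hw₀, fun y hy => hmax₀ hy⟩
  have hmax : ∀ w' ∈ commonPolytope g h, ∑ v, w' v ≤ ∑ v, w v := fun w' hw' => by
    simpa only [hℓ] using hw.1.2 w' hw'
  replace hw := hexp.isExtreme.extremePoints_subset_extremePoints hw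
  have hpt {F : Finset V} (hF : F.Nonempty) (hpos : ∀ v ∈ F, w v ≠ 0) :
      ∃ k ≥ p, ∃ m : ℤ, ∃ z ∈ F, ∃ A : Finset V, ∑ v ∈ A, w v = k * m ∧ z ∈ A ∧
        ∀ u ∈ A, u ∈ F → u = z := by
    obtain ⟨k, rfl | rfl, z, hz, D, E, h1, h2⟩ := exists_tight_sdiff_of_mem_extremePoints hg hh
      (by simp [hgdef, hr0]) (by simp [hhdef, hs0]) hw hF hpos
    · exact ⟨p, le_rfl, r D - r E, z, hz, D \ E, by rw [h1]; push_cast; ring, h2⟩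
    · exact ⟨q, hpq, s D - s E, z, hz, D \ E, by rw [h1]; push_cast; ring, h2⟩
  have hint : ∀ v, ∃ n : ℤ, w v = n := by
    by_contra! hcon
    obtain ⟨k, -, m, z, hz, A, hA, hzA, huniq⟩ := hpt
      (F := univ.filter fun v => ∀ n : ℤ, w v ≠ n)
      (by obtain ⟨v, hv⟩ := hcon; exact ⟨v, by simpa using hv⟩)
      (fun v hv => by simpa using (mem_filter.1 hv).2 0)
    have hrest : ∃ n : ℤ, ∑ v ∈ A.erase z, w v = n := by
      have : ∀ v ∈ A.erase z, w v = (⌊w v⌋ : ℤ) := by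
        intro v hv
        by_contra hne
        refine (mem_erase.1 hv).1 (huniq v (mem_erase.1 hv).2 ?_)
        simp only [mem_filter, mem_univ, true_and]
        rintro n hn
        exact hne (by simp [hn])
      exact ⟨∑ v ∈ A.erase z, ⌊w v⌋, by rw [sum_congr rfl this]; push_cast; rfl⟩
    obtain ⟨n, hn⟩ := hrest
    refine (mem_filter.1 hz).2 (k * m - n) ?_
    have := add_sum_erase A w hzA
    push_cast
    linarith
  have hnat : ∀ v, ∃ n : ℕ, w v = n := by
    intro v
    obtain ⟨n, hn⟩ := hint v
    lift n to ℕ using by exact_mod_cast hn ▸ hw.1.1 v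
    exact ⟨n, by simpa using hn⟩
  choose w' hw' using hnat
  obtain rfl : w = fun v => (w' v : ℝ) := funext hw'
  have hfeas := hw.1
  simp only [commonPolytope, Set.mem_ofPred_eq, hgdef, hhdef] at hfeas hmax
  have hle : ∀ S, ∑ v ∈ S, w' v ≤ p * r S := fun S => mod_cast hfeas.2.1 S
  refine ⟨w', hle, fun S => mod_cast hfeas.2.2 S, ?_, ?_⟩
  · intro u hu1 hu2
    have := hmax (fun v => (u v : ℝ))
      ⟨fun v => Nat.cast_nonneg _, fun S => by exact_mod_cast hu1 S,
        fun S => by exact_mod_cast hu2 S⟩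
    exact_mod_cast this
  · intro hne
    obtain ⟨v, hv⟩ := Function.ne_iff.1 hne
    obtain ⟨k, hk, m, z, hz, A, hA, hzA, huniq⟩ := hpt (F := univ.filter fun v => w' v ≠ 0)
      ⟨v, by simpa using hv⟩ (fun v hv => by simpa using hv)
    refine ⟨z, ?_⟩
    have hzle : w' z ≤ p := by
      simpa using (hle {z}).trans (Nat.mul_le_mul_left p (hr1 z))
    have hsum : ∑ v ∈ A, (w' v : ℝ) = w' z := by
      refine sum_eq_single_of_mem z hzA fun u hu huz => ?_
      by_contra hu0
      exact huz (huniq u hu (by simpa using hu0))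
    have hdvd : k ∣ w' z := by
      rw [hsum] at hA
      exact Int.natCast_dvd_natCast.1 ⟨m, by exact_mod_cast hA⟩
    have := Nat.le_of_dvd (Nat.pos_of_ne_zero (by simpa using hz)) hdvd
    omega

end Perturbation

section Rado

open Finset

/-- **Rado's theorem** for a monotone submodular function. -/
theorem IsSubmodular.exists_transversal {ι E : Type*} [Fintype ι] [DecidableEq ι] [DecidableEq E]
    {f : Finset E → ℕ} (hf : IsSubmodular f) (hmono : Monotone f) (hf0 : f ∅ = 0)
    (A : ι → Finset E) (hA : ∀ K : Finset ι, #K ≤ f (K.biUnion A)) :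
    ∃ a : ι → E, (∀ i, a i ∈ A i) ∧ ∀ K : Finset ι, #K ≤ f (K.image a) := by
  induction hn : ∑ i, #(A i) using Nat.strong_induction_on generalizing A with
  | _ n ih =>
  by_cases hone : ∃ i, 1 < #(A i)
  · obtain ⟨i, hi⟩ := hone
    obtain ⟨x, hx, y, hy, hxy⟩ := one_lt_card.1 hi
    have step (x : E) (hx : x ∈ A i) :
        (∃ a : ι → E, (∀ i, a i ∈ A i) ∧ ∀ K : Finset ι, #K ≤ f (K.image a)) ∨
        ∃ K : Finset ι, i ∉ K ∧ f (K.biUnion A ∪ (A i).erase x) < #K + 1 := by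
      set A' := Function.update A i ((A i).erase x) with hA'
      have hsub : ∀ j, A' j ⊆ A j := fun j => by
        rcases eq_or_ne j i with rfl | hj
        · simp [hA', erase_subset]
        · simp [hA', hj]
      by_cases h : ∀ K : Finset ι, #K ≤ f (K.biUnion A')
      · left
        obtain ⟨a, ha, hK⟩ := ih (∑ j, #(A' j))
          (hn ▸ sum_lt_sum (fun j _ => card_le_card (hsub j))
            ⟨i, mem_univ _, by simpa [hA'] using card_erase_lt_of_mem hx⟩) A' h rfl
        exact ⟨a, fun j => hsub j (ha j), hK⟩
      · right
        push Not at h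
        obtain ⟨K, hK⟩ := h
        have congr_erase : (K.erase i).biUnion A' = (K.erase i).biUnion A :=
          biUnion_congr rfl fun j hj => by simp [hA', ne_of_mem_erase hj]
        have hiK : i ∈ K := by
          by_contra hiK
          rw [erase_eq_of_notMem hiK] at congr_erase
          exact absurd (hA K) (by rw [← congr_erase]; omega)
        refine ⟨K.erase i, notMem_erase _ _, ?_⟩
        rw [card_erase_add_one hiK, ← congr_erase]
        have hunion : K.biUnion A' = (K.erase i).biUnion A' ∪ (A i).erase x := by
          nth_rw 1 [← insert_erase hiK]
          rw [biUnion_insert, union_comm]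
          simp [hA']
        rwa [← hunion]
    rcases step x hx with h | ⟨K, hiK, hK⟩
    · exact h
    rcases step y hy with h | ⟨L, hiL, hL⟩
    · exact h
    exfalso
    have h1 := hf (K.biUnion A ∪ (A i).erase x) (L.biUnion A ∪ (A i).erase y)
    have h2 : #(insert i (K ∪ L)) ≤
        f ((K.biUnion A ∪ (A i).erase x) ∪ (L.biUnion A ∪ (A i).erase y)) := by
      refine (hA _).trans (hmono fun v hv => ?_)
      rw [biUnion_insert, union_biUnion] at hv
      simp only [mem_union, mem_erase] at hv ⊢
      by_cases hvx : v = x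
      · subst hvx; tauto
      · tauto
    have h3 : #(K ∩ L) ≤
        f ((K.biUnion A ∪ (A i).erase x) ∩ (L.biUnion A ∪ (A i).erase y)) :=
      (hA _).trans (hmono (subset_inter
        ((biUnion_subset_biUnion_of_subset_left A inter_subset_left).trans subset_union_left)
        ((biUnion_subset_biUnion_of_subset_left A inter_subset_right).trans subset_union_left)))
    rw [card_insert_of_notMem (by simp [hiK, hiL])] at h2
    have h4 := card_union_add_card_inter K L
    omega
  · push Not at hone
    have hne : ∀ i, (A i).Nonempty := fun i => by
      by_contra h
      have := hA {i}
      simp [not_nonempty_iff_eq_empty.1 h, hf0] at this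
    choose a ha using hne
    have hAa : A = fun i => {a i} := funext fun i =>
      eq_singleton_iff_unique_mem.2 ⟨ha i, fun b hb => card_le_one.1 (hone i) b hb _ (ha i)⟩
    refine ⟨a, ha, fun K => ?_⟩
    have := hA K
    rwa [hAa, biUnion_singleton] at this

end Rado

section Rank

open Finset

variable {V : Type*} [DecidableEq V]

namespace FinMatroid

open Classical in
/-- The rank of a set: the largest size of an independent subset. -/
noncomputable def rk (M : FinMatroid V) (S : Finset V) : ℕ :=
  (S.powerset.filter M.Indep).sup card

variable (M : FinMatroid V)

theorem card_le_rk {I S : Finset V} (hI : M.Indep I) (hIS : I ⊆ S) : #I ≤ M.rk S := by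
  classical
  exact le_sup (f := card) (mem_filter.2 ⟨mem_powerset.2 hIS, hI⟩)

theorem exists_indep_card_eq_rk (S : Finset V) : ∃ I ⊆ S, M.Indep I ∧ #I = M.rk S := by
  classical
  obtain ⟨I, hI, h⟩ := exists_mem_eq_sup (S.powerset.filter M.Indep)
    ⟨∅, mem_filter.2 ⟨empty_mem_powerset S, M.empty_indep⟩⟩ card
  obtain ⟨hIS, hI⟩ := mem_filter.1 hI
  exact ⟨I, mem_powerset.1 hIS, hI, h.symm⟩

theorem exists_superset_card_eq_rk {I S : Finset V} (hI : M.Indep I) (hIS : I ⊆ S) :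
    ∃ J, I ⊆ J ∧ J ⊆ S ∧ M.Indep J ∧ #J = M.rk S := by
  classical
  obtain ⟨J, hJ, hmax⟩ := exists_max_image (S.powerset.filter fun J => M.Indep J ∧ I ⊆ J) card
    ⟨I, by simp [hI, hIS]⟩
  simp only [mem_filter, mem_powerset] at hJ hmax
  obtain ⟨hJS, hJ, hIJ⟩ := hJ
  refine ⟨J, hIJ, hJS, hJ, (M.card_le_rk hJ hJS).antisymm ?_⟩
  obtain ⟨B, hBS, hB, hcard⟩ := M.exists_indep_card_eq_rk S
  by_contra! hlt
  obtain ⟨v, hvB, hvJ, hv⟩ := M.augment hJ hB (hcard ▸ hlt)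
  have := hmax (insert v J)
    ⟨insert_subset (hBS hvB) hJS, hv, hIJ.trans (subset_insert v J)⟩
  rw [card_insert_of_notMem hvJ] at this
  omega

theorem rk_le_card (S : Finset V) : M.rk S ≤ #S := by
  obtain ⟨I, hIS, -, h⟩ := M.exists_indep_card_eq_rk S
  exact h ▸ card_le_card hIS

theorem indep_of_card_le_rk {S : Finset V} (h : #S ≤ M.rk S) : M.Indep S := by
  obtain ⟨I, hIS, hI, hcard⟩ := M.exists_indep_card_eq_rk S
  exact eq_of_subset_of_card_le hIS (hcard ▸ h) ▸ hI

theorem rk_empty : M.rk ∅ = 0 := Nat.le_zero.1 (M.rk_le_card ∅)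

theorem rk_mono : Monotone M.rk := fun S T hST => by
  obtain ⟨I, hIS, hI, h⟩ := M.exists_indep_card_eq_rk S
  exact h ▸ M.card_le_rk hI (hIS.trans hST)

theorem isSubmodular_rk : IsSubmodular M.rk := by
  intro S T
  obtain ⟨I, hIST, hI, hIcard⟩ := M.exists_indep_card_eq_rk (S ∩ T)
  obtain ⟨J, hIJ, hJ, hJi, hJcard⟩ := M.exists_superset_card_eq_rk hI
    (hIST.trans (inter_subset_left.trans subset_union_left : S ∩ T ⊆ S ∪ T))
  have h1 := M.card_le_rk (M.subset_indep hJi inter_subset_left) (inter_subset_right : J ∩ S ⊆ S)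
  have h2 := M.card_le_rk (M.subset_indep hJi inter_subset_left) (inter_subset_right : J ∩ T ⊆ T)
  have h3 := card_union_add_card_inter (J ∩ S) (J ∩ T)
  rw [← inter_union_distrib_left, inter_eq_left.2 hJ, ← inter_inter_distrib_left] at h3
  have h4 : #I ≤ #(J ∩ (S ∩ T)) := card_le_card (subset_inter hIJ hIST)
  omega

end FinMatroid

theorem sum_cnt {k : ℕ} (A : Fin k → Finset V) (S : Finset V) :
    ∑ v ∈ S, cnt A v = ∑ i, #(A i ∩ S) := by
  simp only [cnt, card_filter]
  rw [sum_comm]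
  refine sum_congr rfl fun i _ => ?_
  rw [← card_filter, filter_mem_eq_inter, inter_comm]

theorem FinMatroid.sum_cnt_le (M : FinMatroid V) {k : ℕ} {A : Fin k → Finset V}
    (hA : ∀ i, M.Indep (A i)) (S : Finset V) : ∑ v ∈ S, cnt A v ≤ k * M.rk S := by
  rw [sum_cnt]
  simpa using sum_le_card_nsmul univ (fun i => #(A i ∩ S)) (M.rk S) fun i _ =>
    M.card_le_rk (M.subset_indep (hA i) inter_subset_left) inter_subset_right

/-- **Matroid partition**: a multiplicity vector bounded by `k` times the rank function is the
counting vector of `k` independent sets. -/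
theorem FinMatroid.exists_cnt_eq [Fintype V] (M : FinMatroid V) {k : ℕ} {w : V → ℕ}
    (hw : ∀ S, ∑ v ∈ S, w v ≤ k * M.rk S) :
    ∃ A : Fin k → Finset V, (∀ i, M.Indep (A i)) ∧ ∀ v, cnt A v = w v := by
  classical
  let slice (S : Finset (V × Fin k)) (i : Fin k) : Finset V := {v | (v, i) ∈ S}
  let f (S : Finset (V × Fin k)) : ℕ := ∑ i, M.rk (slice S i)
  have hslice (S : Finset (V × Fin k)) : ∑ i, #(slice S i) = #S := by
    rw [card_eq_sum_card_fiberwise (f := Prod.snd) (t := univ) (by simp)]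
    refine sum_congr rfl fun i _ => card_bij (fun v _ => (v, i)) ?_ ?_ ?_
    · simp [slice]
    · simp
    · rintro ⟨v, j⟩ h
      obtain ⟨h, rfl⟩ := mem_filter.1 h
      exact ⟨v, by simpa [slice] using h, rfl⟩
  have hf : IsSubmodular f := by
    intro S T
    simp only [f, ← sum_add_distrib]
    refine sum_le_sum fun i _ => ?_
    convert M.isSubmodular_rk (slice S i) (slice T i) using 3 <;> ext v <;> simp [slice]
  have hmono : Monotone f := fun S T hST =>
    sum_le_sum fun i _ => M.rk_mono fun v hv => by
      simp only [slice, mem_filter, mem_univ, true_and] at hv ⊢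
      exact hST hv
  obtain ⟨a, ha, hK⟩ := hf.exists_transversal hmono (by simp [f, slice, M.rk_empty])
    (fun x : Σ v, Fin (w v) => ({x.1} : Finset V) ×ˢ (univ : Finset (Fin k))) (by
      intro K
      have hsl : ∀ i, slice (K.biUnion fun x => ({x.1} : Finset V) ×ˢ univ) i =
          K.image Sigma.fst := by
        intro i
        ext v
        simp [slice, eq_comm]
      simp only [f, hsl, sum_const, card_univ, Fintype.card_fin, smul_eq_mul]
      refine le_trans ?_ (hw _)
      calc #K ≤ #((K.image Sigma.fst).sigma fun v => (univ : Finset (Fin (w v)))) :=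
            card_le_card fun x hx => mem_sigma.2 ⟨mem_image_of_mem _ hx, mem_univ _⟩
        _ = _ := by simp)
  set R := univ.image a with hR
  have hle : #(univ : Finset (Σ v, Fin (w v))) ≤ f R := hK univ
  have hterm : ∀ i ∈ (univ : Finset (Fin k)), M.rk (slice R i) ≤ #(slice R i) :=
    fun i _ => M.rk_le_card _
  have hfR : f R ≤ #R := hslice R ▸ sum_le_sum hterm
  have hRle : #R ≤ #(univ : Finset (Σ v, Fin (w v))) := card_image_le
  have hinj : Function.Injective a := fun x y hxy =>
    card_image_iff.1 (hRle.antisymm (hle.trans hfR)) (mem_univ x) (mem_univ y) hxy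
  have heq : ∑ i, M.rk (slice R i) = ∑ i, #(slice R i) :=
    le_antisymm (sum_le_sum hterm) ((hslice R).trans_le (hRle.trans hle))
  refine ⟨slice R, fun i => M.indep_of_card_le_rk
    ((sum_eq_sum_iff_of_le hterm).1 heq i (mem_univ i)).ge, fun v => ?_⟩
  have hfst : ∀ x, (a x).1 = x.1 := fun x => by
    simpa using (mem_product.1 (ha x)).1
  have : w v = #(univ : Finset (Fin (w v))) := by simp
  rw [this]
  refine (card_bij (fun j _ => (a ⟨v, j⟩).2) ?_ ?_ ?_).symm
  · intro j _
    simp only [slice, mem_filter, mem_univ, true_and, hR, mem_image]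
    exact ⟨⟨v, j⟩, Prod.ext (hfst _) rfl⟩
  · intro j _ j' _ h
    have := hinj (Prod.ext ((hfst ⟨v, j⟩).trans (hfst ⟨v, j'⟩).symm) h)
    simpa using this
  · intro i hi
    simp only [slice, mem_filter, mem_univ, true_and, hR, mem_image] at hi
    obtain ⟨⟨u, j⟩, h⟩ := hi
    obtain rfl : u = v := (hfst ⟨u, j⟩).symm.trans (congrArg Prod.fst h)
    exact ⟨j, mem_univ _, by rw [h]⟩

/-- If `ν_{1,1}` is positive, some element is a nonloop of both matroids. -/
theorem exists_indep_singleton_of_nu_pos [Fintype V] {M N : FinMatroid V}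
    (h : 0 < nu 1 1 M.Indep N.Indep) : ∃ v, M.Indep {v} ∧ N.Indep {v} := by
  by_contra! hcon
  refine h.not_ge (csSup_le ⟨_, fun _ => ∅, fun _ => ∅, fun _ => M.empty_indep,
    fun _ => N.empty_indep, rfl⟩ ?_)
  rintro _ ⟨A, B, hA, hB, rfl⟩
  refine (sum_eq_zero fun v _ => ?_).le
  by_contra hv
  have hpos : 0 < cnt A v ∧ 0 < cnt B v := by omega
  simp only [cnt, card_pos] at hpos
  obtain ⟨⟨i, hi⟩, j, hj⟩ := hpos
  simp only [mem_filter, mem_univ, true_and] at hi hj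
  exact hcon v (M.subset_indep (hA i) (singleton_subset_iff.2 hi))
    (N.subset_indep (hB j) (singleton_subset_iff.2 hj))

end Rank

/-- Lemma "dangling": if `ν_{1,1}(M,N) > 0` and `p ≤ q` are positive integers, then
there are `X_1,…,X_p ∈ M`, `Y_1,…,Y_q ∈ N` and `z ∈ V` with
`#v(X_1,…,X_p) = #v(Y_1,…,Y_q)` for every `v ≠ z`, `z` in every `X_i`, and
`Σⱼ |Yⱼ| = ν_{p,q}(M,N)`. -/
theorem dangling {V : Type*} [DecidableEq V] [Fintype V] (p q : ℕ)
    (hp : 0 < p) (hpq : p ≤ q) (M N : FinMatroid V)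
    (hnu : 0 < nu 1 1 M.Indep N.Indep) :
    ∃ (X : Fin p → Finset V) (Y : Fin q → Finset V) (z : V),
      (∀ i, M.Indep (X i)) ∧ (∀ j, N.Indep (Y j)) ∧
      (∀ v : V, v ≠ z → cnt X v = cnt Y v) ∧
      (∀ i, z ∈ X i) ∧
      (∑ j, (Y j).card) = nu p q M.Indep N.Indep := by
  obtain ⟨w, hwM, hwN, hmax, hz⟩ := exists_integral_max_eq M.isSubmodular_rk N.isSubmodular_rk
    M.rk_empty N.rk_empty (fun v => M.rk_le_card {v}) hpq
  obtain ⟨X, hX, hcX⟩ := M.exists_cnt_eq hwM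
  obtain ⟨Y, hY, hcY⟩ := N.exists_cnt_eq hwN
  have hw : w ≠ 0 := by
    rintro rfl
    obtain ⟨v, hvM, hvN⟩ := exists_indep_singleton_of_nu_pos hnu
    have single_le (K : FinMatroid V) (hv : K.Indep {v}) {k : ℕ} (hk : 0 < k) (S : Finset V) :
        ∑ u ∈ S, (Pi.single v 1 : V → ℕ) u ≤ k * K.rk S := by
      simp only [Pi.single_apply, Finset.sum_ite_eq']
      split_ifs with hvS
      · exact Nat.mul_pos hk (K.card_le_rk hv (Finset.singleton_subset_iff.2 hvS))
      · exact Nat.zero_le _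
    have := hmax (Pi.single v 1) (single_le M hvM hp) (single_le N hvN (hp.trans_le hpq))
    simp at this
  obtain ⟨z, hz⟩ := hz hw
  refine ⟨X, Y, z, hX, hY, fun v _ => (hcX v).trans (hcY v).symm, ?_, ?_⟩
  · have hcard : (Finset.univ.filter fun i => z ∈ X i).card = Fintype.card (Fin p) := by
      rw [Fintype.card_fin]
      exact (hcX z).trans hz
    intro i
    have := (Finset.card_eq_iff_eq_univ _).1 hcard
    simpa using this.ge (Finset.mem_univ i)
  · have hsum : ∑ j, (Y j).card = ∑ v, w v := by
      simpa [hcY] using (sum_cnt Y Finset.univ).symm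
    rw [hsum]
    refine Eq.symm (IsGreatest.csSup_eq ⟨?_, ?_⟩)
    · exact ⟨X, Y, hX, hY, by simp [hcX, hcY]⟩
    rintro _ ⟨A, B, hA, hB, rfl⟩
    exact hmax _
      (fun S => (Finset.sum_le_sum fun v _ => min_le_left _ _).trans (M.sum_cnt_le hA S))
      (fun S => (Finset.sum_le_sum fun v _ => min_le_right _ _).trans (N.sum_cnt_le hB S))
end
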